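/- arXiv:2305.09314 — 3 statements merged into one kernel-verified Lean document; each statement's English description precedes it below -/
import Mathlib

section
/- Let φ be an object allocation mechanism and θ ∈ Θ a problem. Then the auditability index of φ at θ equals 1 (i.e., #φ^θ = 1) if and only if φ has a sequential clinching implementation at θ. -/
/-! ## General auditability framework (Grigoryan–Möller, "A Theory of Auditability") -/

section Audit

variable {ι : Type*} [Fintype ι] [DecidableEq ι]
variable {Θi : ι → Type*} {Ωi : ι → Type*}

/-- A nonempty group `G` detects the deviation `ω ≠ φ θ`: for every feasible problem
that agrees with `θ` on `G`, some member of `G` receives an outcome different from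
her outcome under `ω`. -/
def Detects (ΘS : Set (∀ i, Θi i)) (φ : (∀ i, Θi i) → (∀ i, Ωi i))
    (θ : ∀ i, Θi i) (ω : ∀ i, Ωi i) (G : Finset ι) : Prop :=
  G.Nonempty ∧ ∀ θ' ∈ ΘS, (∀ i ∈ G, θ' i = θ i) → ∃ i ∈ G, ω i ≠ φ θ' i

/-- The minimal size of a group detecting the deviation `ω`. -/
noncomputable def minDetect (ΘS : Set (∀ i, Θi i)) (φ : (∀ i, Θi i) → (∀ i, Ωi i))
    (θ : ∀ i, Θi i) (ω : ∀ i, Ωi i) : ℕ :=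
  sInf {n | ∃ G : Finset ι, G.card = n ∧ Detects ΘS φ θ ω G}

/-- The auditability index `#φ^θ`: the maximum over feasible deviations `ω ≠ φ θ`
of the minimal size of a detecting group. -/
noncomputable def auditIndex (ΩS : Set (∀ i, Ωi i)) (ΘS : Set (∀ i, Θi i))
    (φ : (∀ i, Θi i) → (∀ i, Ωi i)) (θ : ∀ i, Θi i) : ℕ :=
  sSup {n | ∃ ω ∈ ΩS, ω ≠ φ θ ∧ minDetect ΘS φ θ ω = n}

/-- The worst-case auditability index `#φ`. -/
noncomputable def worstIndex (ΩS : Set (∀ i, Ωi i)) (ΘS : Set (∀ i, Θi i))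
    (φ : (∀ i, Θi i) → (∀ i, Ωi i)) : ℕ :=
  sSup {n | ∃ θ ∈ ΘS, auditIndex ΩS ΘS φ θ = n}

end Audit

/-! ## Object allocation without money -/

section ObjectAlloc

variable {N : ℕ} {Θi : Fin N → Type*}

/-- Feasible outcomes: bijections from the `N` individuals to the `N` objects. -/
def allocΩS (N : ℕ) : Set (Fin N → Fin N) := {ω | Function.Bijective ω}

/-- Object `o` is possible for individual `i` at type report `θi`. -/
def Possible (ΘS : Set (∀ i, Θi i)) (φ : (∀ i, Θi i) → (Fin N → Fin N))
    (i : Fin N) (θi : Θi i) (o : Fin N) : Prop :=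
  ∃ θ ∈ ΘS, θ i = θi ∧ φ θ i = o

/-- Individual `i` clinches object `o` from the set `avail` at type report `θi`:
`o` is the unique object in `avail` that is possible for `i` at `θi`. -/
def Clinches (ΘS : Set (∀ i, Θi i)) (φ : (∀ i, Θi i) → (Fin N → Fin N))
    (i : Fin N) (θi : Θi i) (o : Fin N) (avail : Set (Fin N)) : Prop :=
  o ∈ avail ∧ Possible ΘS φ i θi o ∧
    ∀ o' ∈ avail, Possible ΘS φ i θi o' → o' = o

/-- `φ` has a sequential clinching implementation at `θ`: there is an order `σ` over the
individuals such that, at each step `t`, the individual `σ t` clinches her `φ θ`-assignment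
from the objects still available (those not assigned in earlier steps). -/
def SeqClinching (ΘS : Set (∀ i, Θi i)) (φ : (∀ i, Θi i) → (Fin N → Fin N))
    (θ : ∀ i, Θi i) : Prop :=
  ∃ σ : Fin N → Fin N, Function.Bijective σ ∧
    ∀ t : Fin N, Clinches ΘS φ (σ t) (θ (σ t)) (φ θ (σ t))
      {o | ∀ s : Fin N, s < t → φ θ (σ s) ≠ o}

end ObjectAlloc

/-- A permutation of a finite set that is supported on the periodic points of a self-map `f`
and agrees with `f` there. -/
theorem exists_bijective_eq_on_periodicPts {α : Type*} [Finite α] (f : α → α) :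
    ∃ g : α → α, Function.Bijective g ∧ (∀ a, g a = f a ∨ g a = a) ∧
      ∀ a ∈ Function.periodicPts f, g a = f a := by
  classical
  have hB := Function.bijOn_periodicPts f
  refine ⟨fun a => if a ∈ Function.periodicPts f then f a else a, ?_, ?_, ?_⟩
  · refine Finite.injective_iff_bijective.mp fun a b hab => ?_
    by_cases ha : a ∈ Function.periodicPts f <;> by_cases hb : b ∈ Function.periodicPts f <;>
      simp only [ha, hb, if_true, if_false] at hab
    · exact hB.injOn ha hb hab
    · exact absurd (hab ▸ hB.mapsTo ha) hb
    · exact absurd (hab ▸ hB.mapsTo hb) ha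
    · exact hab
  · intro a
    by_cases ha : a ∈ Function.periodicPts f <;> simp [ha]
  · intro a ha
    simp [ha]

/-- Some iterate of any point of a finite set under a self-map is periodic. -/
theorem exists_iterate_mem_periodicPts {α : Type*} [Finite α] (f : α → α) (x : α) :
    ∃ n, f^[n] x ∈ Function.periodicPts f := by
  obtain ⟨m, n, hne, h⟩ := Finite.exists_ne_map_eq_of_infinite fun n : ℕ => f^[n] x
  wlog hlt : m < n generalizing m n
  · exact this n m hne.symm h.symm (by omega)
  refine ⟨m, Function.mk_mem_periodicPts (n := n - m) (by omega) ?_⟩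
  change f^[n - m] (f^[m] x) = f^[m] x
  rw [← Function.iterate_add_apply, Nat.sub_add_cancel hlt.le]
  exact h.symm

/-- If the identity is the only permutation `g` with `p a (g a)` for all `a`, and `p` is reflexive,
then the off-diagonal part of `p` has no cycles, i.e. its converse is well-founded. -/
theorem wellFounded_of_unique_perm {α : Type*} [Finite α] (p : α → α → Prop)
    (hrefl : ∀ a, p a a)
    (huniq : ∀ g : α → α, Function.Bijective g → (∀ a, p a (g a)) → g = id) :
    WellFounded fun b a => b ≠ a ∧ p a b := by
  rw [WellFounded.wellFounded_iff_has_min]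
  rintro S ⟨x, hx⟩
  by_contra! hS
  have hex : ∀ a, ∃ b, p a b ∧ (a ∈ S → b ∈ S ∧ b ≠ a) := by
    intro a
    by_cases ha : a ∈ S
    · obtain ⟨b, hb, hne, hp⟩ := hS a ha
      exact ⟨b, hp, fun _ => ⟨hb, hne⟩⟩
    · exact ⟨a, hrefl a, fun h => absurd h ha⟩
  choose f hp hf using hex
  obtain ⟨n, hn⟩ := exists_iterate_mem_periodicPts f x
  obtain ⟨g, hg, hgf, hper⟩ := exists_bijective_eq_on_periodicPts f
  have hid : g = id := huniq g hg fun a => by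
    rcases hgf a with h | h <;> rw [h]
    exacts [hp a, hrefl a]
  have hmaps : Set.MapsTo f S S := fun a ha => (hf a ha).1
  refine (hf _ (hmaps.iterate n hx)).2 ?_
  rw [← hper _ hn, hid, id]

/-- A well-founded relation on a finite type can be listed in increasing order. -/
theorem WellFounded.exists_bijective_fin {α : Type*} [Fintype α] {N : ℕ}
    (hN : Fintype.card α = N) {r : α → α → Prop} (hr : WellFounded r) :
    ∃ σ : Fin N → α, Function.Bijective σ ∧ ∀ s t, r (σ s) (σ t) → s < t := by
  classical
  have : IsWellFounded α r := ⟨hr⟩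
  obtain ⟨s, hrs, hs⟩ := IsWellFounded.exists_well_order_ge r
  let _ : LinearOrder α := linearOrderOfSTO s
  let e : Fin N ≃o α := Fintype.orderIsoFinOfCardEq α hN
  exact ⟨e, e.bijective, fun a b h => e.lt_iff_lt.mp (hrs _ _ h)⟩

section DetectingGroups

variable {ι : Type*} {Θi Ωi : ι → Type*} {ΘS : Set (∀ i, Θi i)}
  {φ : (∀ i, Θi i) → (∀ i, Ωi i)} {θ : ∀ i, Θi i} {ω : ∀ i, Ωi i}

theorem minDetect_le_card {G : Finset ι} (hG : Detects ΘS φ θ ω G) :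
    minDetect ΘS φ θ ω ≤ G.card :=
  Nat.sInf_le ⟨G, rfl, hG⟩

variable [Fintype ι]

/-- The group of all individuals detects every deviation. -/
theorem detects_univ (h : ω ≠ φ θ) : Detects ΘS φ θ ω Finset.univ := by
  obtain ⟨i, hi⟩ := Function.ne_iff.mp h
  refine ⟨⟨i, Finset.mem_univ i⟩, fun θ' _ hθ' => ⟨i, Finset.mem_univ i, ?_⟩⟩
  rwa [show θ' = θ from funext fun j => hθ' j (Finset.mem_univ j)]

theorem exists_detects_card_eq_minDetect (h : ω ≠ φ θ) :
    ∃ G : Finset ι, G.card = minDetect ΘS φ θ ω ∧ Detects ΘS φ θ ω G :=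
  Nat.sInf_mem (s := {n | ∃ G : Finset ι, G.card = n ∧ Detects ΘS φ θ ω G})
    ⟨_, Finset.univ, rfl, detects_univ h⟩

theorem minDetect_pos (h : ω ≠ φ θ) : 0 < minDetect ΘS φ θ ω := by
  obtain ⟨G, hc, hG⟩ := exists_detects_card_eq_minDetect (ΘS := ΘS) h
  exact hc ▸ hG.1.card_pos

theorem minDetect_eq_one_iff (h : ω ≠ φ θ) :
    minDetect ΘS φ θ ω = 1 ↔ ∃ i, ∀ θ' ∈ ΘS, θ' i = θ i → ω i ≠ φ θ' i := by
  constructor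
  · intro h1
    obtain ⟨G, hc, hG⟩ := exists_detects_card_eq_minDetect (ΘS := ΘS) h
    obtain ⟨i, rfl⟩ := Finset.card_eq_one.mp (hc.trans h1)
    exact ⟨i, fun θ' hθ' hi => by simpa using hG.2 θ' hθ' (by simpa using hi)⟩
  · rintro ⟨i, hi⟩
    have hG : Detects ΘS φ θ ω {i} :=
      ⟨Finset.singleton_nonempty i, fun θ' hθ' h' => by simpa using hi θ' hθ' (by simpa using h')⟩
    have := minDetect_le_card hG
    rw [Finset.card_singleton] at this
    have := minDetect_pos (ΘS := ΘS) h
    omega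

/-- When a feasible deviation exists, the auditability index is `1` iff every feasible deviation is
detected by a single individual. -/
theorem auditIndex_eq_one_iff {ΩS : Set (∀ i, Ωi i)} (hdev : ∃ ω ∈ ΩS, ω ≠ φ θ) :
    auditIndex ΩS ΘS φ θ = 1 ↔
      ∀ ω ∈ ΩS, ω ≠ φ θ → ∃ i, ∀ θ' ∈ ΘS, θ' i = θ i → ω i ≠ φ θ' i := by
  set A := {n | ∃ ω ∈ ΩS, ω ≠ φ θ ∧ minDetect ΘS φ θ ω = n}
  have hbdd : BddAbove A := by
    refine ⟨(Finset.univ : Finset ι).card, ?_⟩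
    rintro n ⟨ω, -, hne, rfl⟩
    exact minDetect_le_card (detects_univ hne)
  change sSup A = 1 ↔ _
  constructor
  · intro h ω hω hne
    refine (minDetect_eq_one_iff hne).mp (le_antisymm ?_ (minDetect_pos hne))
    exact h ▸ le_csSup hbdd ⟨ω, hω, hne, rfl⟩
  · intro h
    have hA1 : A = {1} := by
      refine Set.eq_singleton_iff_nonempty_unique_mem.mpr ⟨?_, ?_⟩
      · obtain ⟨ω, hω, hne⟩ := hdev
        exact ⟨_, ω, hω, hne, rfl⟩
      · rintro n ⟨ω, hω, hne, rfl⟩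
        exact (minDetect_eq_one_iff hne).mpr (h ω hω hne)
    rw [hA1, csSup_singleton]

end DetectingGroups

/-- With at least two objects, every allocation has a feasible deviation. -/
theorem exists_allocΩS_ne {N : ℕ} (hN : 2 ≤ N) {μ : Fin N → Fin N} (hμ : Function.Bijective μ) :
    ∃ ω ∈ allocΩS N, ω ≠ μ := by
  have : Nontrivial (Fin N) := Fin.nontrivial_iff_two_le.mpr hN
  obtain ⟨a, b, hab⟩ := exists_pair_ne (Fin N)
  refine ⟨μ ∘ Equiv.swap a b, hμ.comp (Equiv.bijective _), fun h => hab ?_⟩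
  have := congrFun h a
  rw [Function.comp_apply, Equiv.swap_apply_left] at this
  exact (hμ.injective this).symm

/-- Sequential clinching at `θ` amounts to `φ θ` being the only allocation giving every individual
an object that is possible for her. -/
theorem seqClinching_iff_unique {N : ℕ} {Θi : Fin N → Type*} {ΘS : Set (∀ i, Θi i)}
    {φ : (∀ i, Θi i) → (Fin N → Fin N)} {θ : ∀ i, Θi i} (hθ : θ ∈ ΘS)
    (hφ : Function.Bijective (φ θ)) :
    SeqClinching ΘS φ θ ↔
      ∀ ω ∈ allocΩS N, (∀ i, Possible ΘS φ i (θ i) (ω i)) → ω = φ θ := by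
  have hself : ∀ i, Possible ΘS φ i (θ i) (φ θ i) := fun i => ⟨θ, hθ, rfl, rfl⟩
  constructor
  · rintro ⟨σ, hσ, hcl⟩ ω hω hpos
    have key : ∀ t, ω (σ t) = φ θ (σ t) := by
      intro t
      induction t using WellFoundedLT.induction with
      | ind t ih =>
        refine (hcl t).2.2 _ (fun s hs heq => hs.ne ?_) (hpos _)
        exact hσ.injective (hω.injective ((ih s hs).trans heq))
    funext i
    obtain ⟨t, rfl⟩ := hσ.surjective i
    exact key t
  · intro huniq
    have hwf := wellFounded_of_unique_perm (fun i j => Possible ΘS φ i (θ i) (φ θ j)) hself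
      fun g hg hp => funext fun i =>
        hφ.injective (congrFun (huniq (φ θ ∘ g) (hφ.comp hg) hp) i)
    obtain ⟨σ, hσ, hlt⟩ := hwf.exists_bijective_fin (Fintype.card_fin N)
    refine ⟨σ, hσ, fun t => ⟨fun s hs heq => ?_, hself _, fun o ho hp => ?_⟩⟩
    · exact hs.ne (hσ.injective (hφ.injective heq))
    · obtain ⟨u, rfl⟩ := (hφ.comp hσ).surjective o
      by_contra hne
      exact ho u (hlt u t ⟨fun h => hne (congrArg (φ θ) h), hp⟩) rfl

/-- Theorem 1.1: for an object allocation mechanism `φ` and a problem `θ`,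
the auditability index `#φ^θ` equals `1` iff `φ` has a sequential clinching
implementation at `θ`. -/
theorem statement0 {N : ℕ} (hN : 2 ≤ N) {Θi : Fin N → Type*}
    (φ : (∀ i, Θi i) → (Fin N → Fin N))
    (hφ : ∀ θ : ∀ i, Θi i, Function.Bijective (φ θ))
    (θ : ∀ i, Θi i) :
    auditIndex (allocΩS N) (Set.univ : Set (∀ i, Θi i)) φ θ = 1 ↔
      SeqClinching (Set.univ : Set (∀ i, Θi i)) φ θ := by
  rw [auditIndex_eq_one_iff (exists_allocΩS_ne hN (hφ θ)),
    seqClinching_iff_unique (Set.mem_univ θ) (hφ θ)]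
  refine forall₂_congr fun ω _ => ?_
  rw [← not_imp_not, not_not]
  have hiff : (¬ ∃ i, ∀ θ' ∈ (Set.univ : Set (∀ i, Θi i)), θ' i = θ i → ω i ≠ φ θ' i) ↔
      ∀ i, Possible Set.univ φ i (θ i) (ω i) := by
    simp only [Possible]
    push Not
    simp only [eq_comm]
  rw [hiff]
end

section
/- Let φ be a priority-based allocation mechanism that is DA-representable through the mapping τ, and let θ = (P, r) be a problem. Then #φ^θ = 2 if and only if for every outcome ω ≠ φ(θ): either ω is not stable at (P, τ(θ)), or ω is stable at (P, τ(θ)) and there exist two individuals i and j such that (a) ω(j) P_i ω(i) and ω(i) P_j ω(j), and (b) for every object o ∉ {ω(i), ω(j)}, either o P_i ω(i) or o P_j ω(j). -/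
/-! ## Priority-based allocation -/

section PriorityBased

variable {N : ℕ}

/-- A type report in the priority-based allocation model: a strict preference
relation over the `N` objects together with a vector of priority scores. -/
abbrev PrioReport (N : ℕ) := (Fin N → Fin N → Prop) × (Fin N → ℝ)

/-- Feasible problems: each preference is a strict total order and priority scores
are strict (no two individuals have the same score at an object). -/
def prioΘS (N : ℕ) : Set (Fin N → PrioReport N) :=
  {θ | (∀ i, IsStrictTotalOrder (Fin N) (θ i).1) ∧
       ∀ i j o, i ≠ j → (θ i).2 o ≠ (θ j).2 o}

/-- An outcome `ω` is stable at `(P, r)`: no individual prefers an object assigned to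
somebody with a lower priority score at it. -/
def StableAt (P : Fin N → Fin N → Fin N → Prop) (r : Fin N → Fin N → ℝ)
    (ω : Fin N → Fin N) : Prop :=
  ¬ ∃ i j o, P i o (ω i) ∧ ω j = o ∧ r i o > r j o

/-- `ω` is the outcome of the individual-proposing Deferred Acceptance algorithm at
`(P, r)`, formalized via the Gale–Shapley characterization: `ω` is the
individual-optimal stable outcome, i.e. the stable outcome that every individual
weakly prefers to every stable outcome. -/
def IsDAOutcome (P : Fin N → Fin N → Fin N → Prop) (r : Fin N → Fin N → ℝ)
    (ω : Fin N → Fin N) : Prop :=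
  Function.Bijective ω ∧ StableAt P r ω ∧
    ∀ ω' : Fin N → Fin N, Function.Bijective ω' → StableAt P r ω' →
      ∀ i, ω i = ω' i ∨ P i (ω i) (ω' i)

/-- The position of object `o` in the strict preference `Pi`
(`1` = most preferred). -/
noncomputable def position (Pi : Fin N → Fin N → Prop) (o : Fin N) : ℕ :=
  Set.ncard {o' | Pi o' o} + 1

/-- The three requirements on the priority-modifying map `τ` of a DA-representation:
independence of irrelevant alternatives, monotonicity, and equal treatment. -/
structure TauAdmissible (N : ℕ)
    (τ : (Fin N → PrioReport N) → (Fin N → Fin N → ℝ)) : Prop where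
  iia : ∀ θ ∈ prioΘS N, ∀ θ' ∈ prioΘS N, ∀ i j o,
    position (θ i).1 o = position (θ' i).1 o →
    position (θ j).1 o = position (θ' j).1 o →
    ((θ i).2 o > (θ j).2 o ↔ (θ' i).2 o > (θ' j).2 o) →
    (τ θ i o > τ θ j o ↔ τ θ' i o > τ θ' j o)
  mono : ∀ θ ∈ prioΘS N, ∀ θ' ∈ prioΘS N, ∀ i j o,
    position (θ' i).1 o ≤ position (θ i).1 o →
    position (θ j).1 o ≤ position (θ' j).1 o →
    ((θ i).2 o > (θ j).2 o → (θ' i).2 o > (θ' j).2 o) →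
    (τ θ i o > τ θ j o → τ θ' i o > τ θ' j o)
  equalTreatment : ∀ θ ∈ prioΘS N, ∀ i j o,
    position (θ i).1 o = position (θ j).1 o →
    (θ i).2 o > (θ j).2 o → τ θ i o > τ θ j o

/-- `φ` is DA-representable through `τ`: `τ` is admissible and, at every problem
`θ = (P, r)`, `φ θ = DA(P, τ θ)`. -/
def DARepresentable (φ : (Fin N → PrioReport N) → (Fin N → Fin N))
    (τ : (Fin N → PrioReport N) → (Fin N → Fin N → ℝ)) : Prop :=
  TauAdmissible N τ ∧
    ∀ θ ∈ prioΘS N, IsDAOutcome (fun i => (θ i).1) (τ θ) (φ θ)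

/-- The condition of Theorem 2 on deviations at a problem with preferences `P` and
(modified) priorities `rmod`: every feasible deviation `ω ≠ φθ` is either unstable at
`(P, rmod)`, or stable and there are two individuals who prefer each other's
`ω`-objects to their own and such that no other object is worse than their own
`ω`-objects for both of them. -/
def TwoDetectableCond (P : Fin N → Fin N → Fin N → Prop)
    (rmod : Fin N → Fin N → ℝ) (φθ : Fin N → Fin N) : Prop :=
  ∀ ω : Fin N → Fin N, Function.Bijective ω → ω ≠ φθ →
    ¬ StableAt P rmod ω ∨
      (StableAt P rmod ω ∧ ∃ i j, i ≠ j ∧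
        P i (ω j) (ω i) ∧ P j (ω i) (ω j) ∧
        ∀ o, o ≠ ω i → o ≠ ω j → (P i o (ω i) ∨ P j o (ω j)))

end PriorityBased

section Framework

variable {ι : Type*} [Fintype ι]
variable {Θi : ι → Type*} {Ωi : ι → Type*}

lemma detects_univ_s3 [Nonempty ι] {ΘS : Set (∀ i, Θi i)} {φ : (∀ i, Θi i) → (∀ i, Ωi i)}
    {θ : ∀ i, Θi i} {ω : ∀ i, Ωi i} (hω : ω ≠ φ θ) : Detects ΘS φ θ ω Finset.univ := by
  refine ⟨Finset.univ_nonempty, fun θ' _ h => ?_⟩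
  obtain rfl : θ' = θ := funext fun i => h i (Finset.mem_univ i)
  simpa using Function.ne_iff.1 hω

/-- If no single individual detects a deviation, the auditability index is `2` exactly when
every deviation is detected by a pair. -/
lemma auditIndex_eq_two_iff [Nonempty ι] {ΩS : Set (∀ i, Ωi i)} {ΘS : Set (∀ i, Θi i)}
    {φ : (∀ i, Θi i) → (∀ i, Ωi i)} {θ : ∀ i, Θi i}
    (hne : ∃ ω ∈ ΩS, ω ≠ φ θ)
    (hsingle : ∀ ω ∈ ΩS, ∀ i, ¬ Detects ΘS φ θ ω {i}) :
    auditIndex ΩS ΘS φ θ = 2 ↔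
      ∀ ω ∈ ΩS, ω ≠ φ θ → ∃ G : Finset ι, G.card = 2 ∧ Detects ΘS φ θ ω G := by
  have hmem : ∀ ω, ω ≠ φ θ →
      ∃ G : Finset ι, G.card = minDetect ΘS φ θ ω ∧ Detects ΘS φ θ ω G := fun ω hω =>
    Nat.sInf_mem (s := {n | ∃ G : Finset ι, G.card = n ∧ Detects ΘS φ θ ω G})
      ⟨_, Finset.univ, rfl, detects_univ_s3 hω⟩
  have hle : ∀ ω (G : Finset ι), Detects ΘS φ θ ω G → minDetect ΘS φ θ ω ≤ G.card :=
    fun ω G hG => Nat.sInf_le ⟨G, rfl, hG⟩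
  have htwo : ∀ ω ∈ ΩS, ω ≠ φ θ → 2 ≤ minDetect ΘS φ θ ω := by
    intro ω hω hωφ
    obtain ⟨G, hG, hdet⟩ := hmem ω hωφ
    have hpos := hdet.1.card_pos
    have hone : G.card ≠ 1 := by
      intro h
      obtain ⟨i, rfl⟩ := Finset.card_eq_one.1 h
      exact hsingle ω hω i hdet
    omega
  have hbdd : BddAbove {n | ∃ ω ∈ ΩS, ω ≠ φ θ ∧ minDetect ΘS φ θ ω = n} := by
    refine ⟨Fintype.card ι, ?_⟩
    rintro _ ⟨ω, -, hω, rfl⟩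
    simpa using hle ω _ (detects_univ_s3 hω)
  constructor
  · intro h ω hω hωφ
    obtain ⟨G, hG, hdet⟩ := hmem ω hωφ
    have h2 : minDetect ΘS φ θ ω ≤ 2 := h ▸ le_csSup hbdd ⟨ω, hω, hωφ, rfl⟩
    exact ⟨G, hG.trans (le_antisymm h2 (htwo ω hω hωφ)), hdet⟩
  · intro h
    have heq : ∀ ω ∈ ΩS, ω ≠ φ θ → minDetect ΘS φ θ ω = 2 := by
      intro ω hω hωφ
      obtain ⟨G, hG, hdet⟩ := h ω hω hωφ
      exact le_antisymm (hG ▸ hle ω G hdet) (htwo ω hω hωφ)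
    obtain ⟨ω, hω, hωφ⟩ := hne
    refine le_antisymm (csSup_le ⟨_, ω, hω, hωφ, rfl⟩ ?_)
      (le_csSup hbdd ⟨ω, hω, hωφ, heq ω hω hωφ⟩)
    rintro _ ⟨ω', hω', hω'φ, rfl⟩
    exact (heq ω' hω' hω'φ).le

end Framework

namespace IsStrictTotalOrder

variable {α : Type*} {r : α → α → Prop}

lemma not_rel_self (h : IsStrictTotalOrder α r) (a : α) : ¬ r a a := h.irrefl a

lemma not_rel_symm (h : IsStrictTotalOrder α r) {a b : α} (hab : r a b) : ¬ r b a :=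
  fun hba => h.irrefl a (h.trans a b a hab hba)

lemma rel_or_rel (h : IsStrictTotalOrder α r) {a b : α} (hab : a ≠ b) : r a b ∨ r b a := by
  by_contra hcon
  push Not at hcon
  exact hab (h.trichotomous a b hcon.1 hcon.2)

end IsStrictTotalOrder

lemma Function.periodicPts_nonempty {α : Type*} [Finite α] [Nonempty α] (f : α → α) :
    (Function.periodicPts f).Nonempty := by
  inhabit α
  obtain ⟨m, n, hmn, h⟩ := Finite.exists_ne_map_eq_of_infinite fun n : ℕ => f^[n] default
  wlog hlt : m < n generalizing m n
  · exact this n m hmn.symm h.symm (by omega)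
  refine ⟨f^[m] default, Function.mk_mem_periodicPts (Nat.sub_pos_of_lt hlt) ?_⟩
  change f^[n - m] (f^[m] default) = f^[m] default
  rw [← Function.iterate_add_apply, Nat.sub_add_cancel hlt.le]
  exact h.symm

section PriorityBased

variable {N : ℕ}

/-- Some object is not preferred by anybody to her deferred acceptance assignment. -/
lemma IsDAOutcome.exists_unenvied [NeZero N] {P : Fin N → Fin N → Fin N → Prop}
    {r : Fin N → Fin N → ℝ} {μ : Fin N → Fin N} (hP : ∀ i, IsStrictTotalOrder (Fin N) (P i))
    (hμ : IsDAOutcome P r μ) : ∃ o, ∀ i, ¬ P i o (μ i) := by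
  classical
  by_contra! hcon
  obtain ⟨hbij, hstab, hopt⟩ := hμ
  have htop : ∀ o, ∃ i, P i o (μ i) ∧ ∀ k, P k o (μ k) → r k o ≤ r i o := by
    intro o
    obtain ⟨i, hi, hmax⟩ := Set.exists_max_image {i | P i o (μ i)} (fun i => r i o)
      (Set.toFinite _) (hcon o)
    exact ⟨i, hi, hmax⟩
  choose f hf hfmax using htop
  set C := Function.periodicPts (fun o => μ (f o))
  have hC : Set.BijOn (fun o => μ (f o)) C C := Function.bijOn_periodicPts _
  let e : Fin N → Fin N := fun o => if o ∈ C then μ (f o) else o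
  have heC : ∀ o ∈ C, e o = μ (f o) := fun o ho => if_pos ho
  have heN : ∀ o ∉ C, e o = o := fun o ho => if_neg ho
  have he : Function.Injective e := by
    intro x y hxy
    by_cases hx : x ∈ C <;> by_cases hy : y ∈ C
    · rw [heC x hx, heC y hy] at hxy
      exact hC.injOn hx hy hxy
    · rw [heC x hx, heN y hy] at hxy
      exact absurd (hxy ▸ hC.mapsTo hx) hy
    · rw [heN x hx, heC y hy] at hxy
      exact absurd (hxy ▸ hC.mapsTo hy) hx
    · rwa [heN x hx, heN y hy] at hxy
  let E := Equiv.ofBijective e (Finite.injective_iff_bijective.1 he)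
  let ν : Fin N → Fin N := fun a => E.symm (μ a)
  have heν : ∀ a, e (ν a) = μ a := fun a => E.apply_symm_apply (μ a)
  have hνC : ∀ a, ν a ∈ C → a = f (ν a) := fun a ha =>
    hbij.injective ((heν a).symm.trans (heC _ ha))
  have hνN : ∀ a, ν a ∉ C → ν a = μ a := fun a ha => (heN _ ha).symm.trans (heν a)
  have hbetter : ∀ a, ν a = μ a ∨ P a (ν a) (μ a) := by
    intro a
    by_cases ha : ν a ∈ C
    · right
      have := hf (ν a)
      rwa [← hνC a ha] at this
    · exact Or.inl (hνN a ha)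
  have hνstab : StableAt P r ν := by
    rintro ⟨a, b, o, hPa, rfl, hr⟩
    have henvy : P a (ν b) (μ a) := by
      rcases hbetter a with h | h
      · rwa [← h]
      · exact (hP a).trans _ _ _ hPa h
    by_cases hb : ν b ∈ C
    · have := hfmax (ν b) a henvy
      rw [← hνC b hb] at this
      exact absurd hr this.not_gt
    · exact hstab ⟨a, b, ν b, henvy, (hνN b hb).symm, hr⟩
  obtain ⟨o, ho⟩ := Function.periodicPts_nonempty (fun o => μ (f o))
  have hνo : ν (f o) = o := he ((heν (f o)).trans (heC o ho).symm)
  have hbad := hf o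
  have hopt' := hopt ν (E.symm.bijective.comp hbij) hνstab (f o)
  rw [hνo] at hopt'
  rcases hopt' with h | h
  · rw [h] at hbad
    exact (hP _).not_rel_self _ hbad
  · exact (hP _).not_rel_symm h hbad

lemma position_eq_one_of_top {Q : Fin N → Fin N → Prop} (hQ : IsStrictTotalOrder (Fin N) Q)
    {t : Fin N} (ht : ∀ x, x ≠ t → Q t x) : position Q t = 1 := by
  have : {o | Q o t} = ∅ := by
    ext o
    simp only [Set.mem_ofPred_eq, Set.mem_empty_iff_false, iff_false]
    intro ho
    rcases eq_or_ne o t with rfl | hne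
    · exact hQ.not_rel_self _ ho
    · exact hQ.not_rel_symm ho (ht o hne)
  simp [position, this]

/-- Everybody outside `G` ranks her `ω`-object first and has the highest score at it. -/
def ClaimsOutside (G : Finset (Fin N)) (ω : Fin N → Fin N) (θ : Fin N → PrioReport N) : Prop :=
  ∀ l ∉ G, (∀ x, x ≠ ω l → (θ l).1 (ω l) x) ∧ ∀ m, m ≠ l → (θ l).2 (ω l) > (θ m).2 (ω l)

lemma exists_top_order (t : Fin N) :
    ∃ Q : Fin N → Fin N → Prop, IsStrictTotalOrder (Fin N) Q ∧ ∀ x, x ≠ t → Q t x := by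
  let f : Fin N → ℕ := fun x => if x = t then 0 else x + 1
  have hf : Function.Injective f := by
    intro x y h
    simp only [f] at h
    split_ifs at h <;> omega
  refine ⟨fun x y => f x < f y, hf.isStrictTotalOrder_onFun (r := (· < ·)), fun x hx => ?_⟩
  simp [f, hx]

lemma exists_claimsOutside (G : Finset (Fin N)) {ω : Fin N → Fin N}
    (hω : Function.Injective ω) (ρ : Fin N → PrioReport N)
    (hρ : ∀ i, IsStrictTotalOrder (Fin N) (ρ i).1)
    (hρG : ∀ i ∈ G, ∀ j ∈ G, ∀ o, i ≠ j → (ρ i).2 o ≠ (ρ j).2 o) :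
    ∃ θ ∈ prioΘS N, (∀ i ∈ G, θ i = ρ i) ∧ ClaimsOutside G ω θ := by
  obtain ⟨M, hM⟩ : ∃ M : ℝ, ∀ i o, (ρ i).2 o ≤ M := by
    obtain ⟨M, hM⟩ := (Set.finite_range fun p : Fin N × Fin N => (ρ p.1).2 p.2).bddAbove
    exact ⟨M, fun i o => hM ⟨(i, o), rfl⟩⟩
  choose Q hQ hQtop using fun t : Fin N => exists_top_order t
  let s : Fin N → Fin N → ℝ := fun l x => if x = ω l then M + 1 + N else M + 1 + (l : ℕ)
  have hsM : ∀ l x, M < s l x := by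
    intro l x
    simp only [s]
    split_ifs <;> have := Nat.cast_nonneg (α := ℝ) N <;>
      have := Nat.cast_nonneg (α := ℝ) (l : ℕ) <;> linarith
  have hlt : ∀ l : Fin N, ((l : ℕ) : ℝ) < N := fun l => by exact_mod_cast l.isLt
  have hs : ∀ l m x, l ≠ m → s l x ≠ s m x := by
    intro l m x hlm h
    have hl := hlt l
    have hm := hlt m
    simp only [s] at h
    split_ifs at h with h1 h2 h2
    · exact hlm (hω (h1.symm.trans h2))
    · linarith
    · linarith
    · exact hlm (Fin.ext (by exact_mod_cast add_left_cancel h))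
  refine ⟨fun l => if l ∈ G then ρ l else (Q (ω l), s l), ⟨fun i => ?_, fun i j o hij => ?_⟩,
    fun i hi => if_pos hi, fun l hl => ⟨?_, fun m hm => ?_⟩⟩
  · dsimp only
    split_ifs
    · exact hρ i
    · exact hQ _
  · dsimp only
    split_ifs with hi hj hj
    · exact hρG i hi j hj o hij
    · exact ((hM i o).trans_lt (hsM j o)).ne
    · exact ((hM j o).trans_lt (hsM i o)).ne'
    · exact hs i j o hij
  · simpa [hl] using hQtop (ω l)
  · dsimp only
    rw [if_neg hl]
    split_ifs with hmG
    · exact (hM m _).trans_lt (hsM l _)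
    · have hne : ω l ≠ ω m := fun h => hm (hω h).symm
      simp [s, hne]

variable {τ : (Fin N → PrioReport N) → (Fin N → Fin N → ℝ)}

lemma TauAdmissible.gt_of_top (hτ : TauAdmissible N τ) {θ : Fin N → PrioReport N}
    (hθ : θ ∈ prioΘS N) {l m t : Fin N} (hml : m ≠ l) (ht : ∀ x, x ≠ t → (θ l).1 t x)
    (hr : (θ l).2 t > (θ m).2 t) : τ θ l t > τ θ m t := by
  let θ₀ := Function.update θ m ((θ l).1, (θ m).2)
  have hm : θ₀ m = ((θ l).1, (θ m).2) := Function.update_self ..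
  have hne : ∀ i, i ≠ m → θ₀ i = θ i := fun i hi => Function.update_of_ne hi ..
  have h2 : ∀ i, (θ₀ i).2 = (θ i).2 := by
    intro i
    rcases eq_or_ne i m with rfl | hi
    · rw [hm]
    · rw [hne i hi]
  have hθ₀ : θ₀ ∈ prioΘS N := by
    refine ⟨fun i => ?_, fun i j o hij => ?_⟩
    · rcases eq_or_ne i m with rfl | hi
      · rw [hm]; exact hθ.1 l
      · rw [hne i hi]; exact hθ.1 i
    · rw [h2, h2]; exact hθ.2 i j o hij
  have hpos : position (θ l).1 t = 1 := position_eq_one_of_top (hθ.1 l) ht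
  refine hτ.mono θ₀ hθ₀ θ hθ l m t ?_ ?_ (fun _ => hr)
    (hτ.equalTreatment θ₀ hθ₀ l m t ?_ ?_)
  · rw [hne l hml.symm]
  · rw [hm, hpos]; simp [position]
  · rw [hm, hne l hml.symm]
  · rw [h2, h2]; exact hr

section Claims

variable {G : Finset (Fin N)} {ω : Fin N → Fin N} {θ : Fin N → PrioReport N}

lemma ClaimsOutside.congr {ω' : Fin N → Fin N} (hc : ClaimsOutside G ω θ)
    (h : ∀ l ∉ G, ω' l = ω l) : ClaimsOutside G ω' θ := by
  intro l hl
  rw [h l hl]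
  exact hc l hl

lemma ClaimsOutside.gt (hc : ClaimsOutside G ω θ) (hτ : TauAdmissible N τ)
    (hθ : θ ∈ prioΘS N) {l m : Fin N} (hl : l ∉ G) (hml : m ≠ l) :
    τ θ l (ω l) > τ θ m (ω l) :=
  hτ.gt_of_top hθ hml (hc l hl).1 ((hc l hl).2 m hml)

lemma ClaimsOutside.eq_of_stable (hc : ClaimsOutside G ω θ) (hτ : TauAdmissible N τ)
    (hθ : θ ∈ prioΘS N) {ν : Fin N → Fin N} (hν : Function.Bijective ν)
    (hs : StableAt (fun i => (θ i).1) (τ θ) ν) {l : Fin N} (hl : l ∉ G) : ν l = ω l := by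
  by_contra hne
  obtain ⟨m, hm⟩ := hν.surjective (ω l)
  have hml : m ≠ l := by
    rintro rfl
    exact hne hm
  exact hs ⟨l, m, ω l, (hc l hl).1 _ hne, hm, hc.gt hτ hθ hl hml⟩

lemma ClaimsOutside.stableAt (hc : ClaimsOutside G ω θ) (hτ : TauAdmissible N τ)
    (hθ : θ ∈ prioΘS N)
    (h : ∀ i ∈ G, ∀ m ∈ G, (θ i).1 (ω m) (ω i) → ¬ τ θ i (ω m) > τ θ m (ω m)) :
    StableAt (fun i => (θ i).1) (τ θ) ω := by
  rintro ⟨i, m, o, hP, rfl, hr⟩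
  have hne : ω m ≠ ω i := by
    intro heq
    rw [heq] at hP
    exact (hθ.1 i).not_rel_self _ hP
  by_cases hi : i ∈ G
  · by_cases hm : m ∈ G
    · exact h i hi m hm hP hr
    · exact lt_asymm hr (hc.gt hτ hθ hm fun h => hne (h ▸ rfl))
  · exact (hθ.1 i).not_rel_symm hP ((hc i hi).1 _ hne)

end Claims

lemma exists_between_side (a b : ℝ) : ∃ v, a < v ∧ v ≠ b ∧ (v < b ↔ a < b) := by
  rcases lt_or_ge a b with h | h
  · obtain ⟨v, hav, hvb⟩ := exists_between h
    exact ⟨v, hav, hvb.ne, by simp [h, hvb]⟩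
  · exact ⟨a + 1, by linarith, by linarith, by constructor <;> intro <;> linarith⟩

variable {φ : (Fin N → PrioReport N) → (Fin N → Fin N)} {θ : Fin N → PrioReport N}
  {ω : Fin N → Fin N}

lemma DARepresentable.apply_eq_of_claimsOutside (hφ : DARepresentable φ τ)
    {G : Finset (Fin N)} (hθ : θ ∈ prioΘS N) (hc : ClaimsOutside G ω θ) {l : Fin N}
    (hl : l ∉ G) : φ θ l = ω l :=
  hc.eq_of_stable hφ.1 hθ (hφ.2 θ hθ).1 (hφ.2 θ hθ).2.1 hl

lemma DARepresentable.not_detects_singleton (hφ : DARepresentable φ τ) (hθ : θ ∈ prioΘS N)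
    (hω : Function.Bijective ω) (i : Fin N) : ¬ Detects (prioΘS N) φ θ ω {i} := by
  rintro ⟨-, hdet⟩
  obtain ⟨θ', hθ', hagree, hc⟩ := exists_claimsOutside {i} hω.injective θ hθ.1
    fun i _ j _ o hij => hθ.2 i j o hij
  obtain ⟨k, hk, hne⟩ := hdet θ' hθ' hagree
  obtain rfl := Finset.mem_singleton.1 hk
  obtain ⟨l, hl⟩ := hω.surjective (φ θ' k)
  rcases eq_or_ne l k with rfl | hlk
  · exact hne hl
  · have := hφ.apply_eq_of_claimsOutside hθ' hc (l := l) (by simpa using hlk)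
    exact hlk ((hφ.2 θ' hθ').1.injective (this.trans hl))

/-- If everybody but `i` and `j` claims her `ω`-object, `i` prefers `ω i` to `ω j`, and `j` has
no higher priority at `ω i`, then `ω` is the outcome. -/
lemma DARepresentable.apply_eq_of_pair (hφ : DARepresentable φ τ) (hθ : θ ∈ prioΘS N)
    (hω : Function.Bijective ω) {i j : Fin N} (hij : i ≠ j) (hc : ClaimsOutside {i, j} ω θ)
    (hi : (θ i).1 (ω i) (ω j)) (hj : (θ j).1 (ω i) (ω j) → ¬ τ θ j (ω i) > τ θ i (ω i)) :
    φ θ = ω := by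
  obtain ⟨hbij, -, hopt⟩ := hφ.2 θ hθ
  have hs : StableAt (fun i => (θ i).1) (τ θ) ω := by
    refine hc.stableAt hφ.1 hθ fun a ha b hb hP => ?_
    simp only [Finset.mem_insert, Finset.mem_singleton] at ha hb
    rcases ha with rfl | rfl <;> rcases hb with rfl | rfl
    · exact lt_irrefl _
    · exact absurd hP ((hθ.1 _).not_rel_symm hi)
    · exact hj hP
    · exact lt_irrefl _
  have hout : ∀ l, l ≠ i → l ≠ j → φ θ l = ω l := fun l h1 h2 =>
    hφ.apply_eq_of_claimsOutside hθ hc (by simp [h1, h2])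
  have hφi : φ θ i = ω i := by
    obtain ⟨l, hl⟩ := hω.surjective (φ θ i)
    by_cases hli : l = i
    · rw [← hl, hli]
    by_cases hlj : l = j
    · subst hlj
      rcases hopt ω hω hs i with h | h
      · exact h
      · rw [← hl] at h
        exact absurd h ((hθ.1 i).not_rel_symm hi)
    · exact absurd (hbij.injective ((hout l hli hlj).trans hl)) hli
  funext l
  by_cases hli : l = i
  · rw [hli, hφi]
  by_cases hlj : l = j
  · subst hlj
    obtain ⟨m, hm⟩ := hω.surjective (φ θ l)
    by_cases hml : m = l
    · rw [← hm, hml]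
    by_cases hmi : m = i
    · exact absurd (hbij.injective (hφi.trans (hmi ▸ hm))).symm hli
    · exact absurd (hbij.injective ((hout m hmi hml).trans hm)) hml
  · exact hout l hli hlj

lemma DARepresentable.exists_pair (hφ : DARepresentable φ τ) (hθ : θ ∈ prioΘS N)
    (hω : Function.Bijective ω) (hs : StableAt (fun i => (θ i).1) (τ θ) ω) {i j : Fin N}
    (hij : i ≠ j) (hi : (θ i).1 (ω i) (ω j)) :
    ∃ θ' ∈ prioΘS N, θ' i = θ i ∧ θ' j = θ j ∧ φ θ' = ω := by
  obtain ⟨θ', hθ', hagree, hc⟩ := exists_claimsOutside {i, j} hω.injective θ hθ.1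
    fun i _ j _ o hij => hθ.2 i j o hij
  have hi' : θ' i = θ i := hagree i (by simp)
  have hj' : θ' j = θ j := hagree j (by simp)
  refine ⟨θ', hθ', hi', hj', hφ.apply_eq_of_pair hθ' hω hij hc (by rwa [hi']) ?_⟩
  rw [hj']
  intro hP hgt
  refine hs ⟨j, i, ω i, hP, rfl, ?_⟩
  exact (hφ.1.iia θ' hθ' θ hθ j i (ω i) (by rw [hj']) (by rw [hi']) (by rw [hi', hj'])).1 hgt

/-- Individuals who do not rank `x` last cannot have tied modified scores at `x`. -/
lemma DARepresentable.ne_of_common_worse (hφ : DARepresentable φ τ) (hθ : θ ∈ prioΘS N)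
    {i j x o : Fin N} (hij : i ≠ j) (hi : (θ i).1 x o) (hj : (θ j).1 x o) :
    τ θ i x ≠ τ θ j x := by
  intro htie
  have hxo : x ≠ o := by
    rintro rfl
    exact (hθ.1 i).not_rel_self _ hi
  obtain ⟨e, hei, hej⟩ : ∃ e : Equiv.Perm (Fin N), e i = x ∧ e j = o := by
    let e₁ := Equiv.swap i x
    refine ⟨e₁.trans (Equiv.swap (e₁ j) o), ?_, by simp⟩
    have h1 : e₁ i = x := Equiv.swap_apply_left i x
    have h2 : x ≠ e₁ j := fun h => hij (e₁.injective (h1.trans h))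
    simp [h1, Equiv.swap_apply_of_ne_of_ne h2 hxo]
  obtain ⟨θ', hθ', hagree, hc⟩ := exists_claimsOutside {i, j} e.injective θ hθ.1
    fun i _ j _ o hij => hθ.2 i j o hij
  have hi' : θ' i = θ i := hagree i (by simp)
  have hj' : θ' j = θ j := hagree j (by simp)
  have hiia := hφ.1.iia θ hθ θ' hθ' i j x (by rw [hi']) (by rw [hj']) (by rw [hi', hj'])
  have hiia' := hφ.1.iia θ hθ θ' hθ' j i x (by rw [hj']) (by rw [hi']) (by rw [hi', hj'])
  have h1 : φ θ' = e := by
    refine hφ.apply_eq_of_pair hθ' e.bijective hij hc ?_ fun _ => ?_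
    · rwa [hi', hei, hej]
    · rw [hei, ← hiia']
      exact htie.ge.not_gt
  have h2 : φ θ' = (Equiv.swap i j).trans e := by
    refine hφ.apply_eq_of_pair hθ' (Equiv.bijective _) hij.symm ?_ ?_ fun _ => ?_
    · rw [Finset.pair_comm]
      refine hc.congr fun l hl => ?_
      simp only [Finset.mem_insert, Finset.mem_singleton, not_or] at hl
      simp [Equiv.swap_apply_of_ne_of_ne hl.1 hl.2]
    · simpa [hi', hj', hei, hej] using hj
    · simp only [Equiv.trans_apply, Equiv.swap_apply_right, hei]
      rw [← hiia]
      exact htie.le.not_gt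
  have := congrFun (h1.symm.trans h2) i
  rw [Equiv.trans_apply, Equiv.swap_apply_left, hei, hej] at this
  exact hxo this

lemma exists_replace (hθ : θ ∈ prioΘS N) (hω : Function.Injective ω) {i j k x : Fin N}
    (hki : k ≠ i) (hkj : k ≠ j) {Q : Fin N → Fin N → Prop} (hQ : IsStrictTotalOrder (Fin N) Q)
    {v : ℝ} (hvi : v ≠ (θ i).2 x) (hvj : v ≠ (θ j).2 x) :
    ∃ θ' ∈ prioΘS N, θ' i = θ i ∧ θ' j = θ j ∧ (θ' k).1 = Q ∧ (θ' k).2 x = v ∧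
      ClaimsOutside {i, j, k} ω θ' := by
  obtain ⟨M, hM⟩ := (Set.finite_range fun p : Fin N × Fin N => (θ p.1).2 p.2).bddAbove
  have hM' : ∀ m o, (θ m).2 o ≠ M + 1 := fun m o => by
    have : (θ m).2 o ≤ M := hM ⟨(m, o), rfl⟩
    linarith
  let s : Fin N → ℝ := fun o => if o = x then v else M + 1
  have hs : ∀ m, m = i ∨ m = j → ∀ o, (θ m).2 o ≠ s o := by
    intro m hm o
    simp only [s]
    split_ifs with ho
    · rcases hm with rfl | rfl
      · exact ho ▸ hvi.symm
      · exact ho ▸ hvj.symm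
    · exact hM' m o
  have hρ : ∀ m, IsStrictTotalOrder (Fin N) (Function.update θ k (Q, s) m).1 := by
    intro m
    rcases eq_or_ne m k with rfl | hm
    · simpa using hQ
    · simpa [hm] using hθ.1 m
  have hρG : ∀ a ∈ ({i, j, k} : Finset (Fin N)), ∀ b ∈ ({i, j, k} : Finset (Fin N)), ∀ o, a ≠ b →
      (Function.update θ k (Q, s) a).2 o ≠ (Function.update θ k (Q, s) b).2 o := by
    intro a ha b hb o hab
    simp only [Finset.mem_insert, Finset.mem_singleton, ← or_assoc] at ha hb
    rcases eq_or_ne a k with hak | hak <;> rcases eq_or_ne b k with hbk | hbk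
    · exact absurd (hak.trans hbk.symm) hab
    · rw [hak, Function.update_self, Function.update_of_ne hbk]
      exact (hs b (hb.resolve_right hbk) o).symm
    · rw [hbk, Function.update_self, Function.update_of_ne hak]
      exact hs a (ha.resolve_right hak) o
    · rw [Function.update_of_ne hak, Function.update_of_ne hbk]
      exact hθ.2 a b o hab
  obtain ⟨θ', hθ', hagree, hc⟩ := exists_claimsOutside {i, j, k} hω _ hρ hρG
  have hk := hagree k (by simp)
  rw [Function.update_self] at hk
  refine ⟨θ', hθ', ?_, ?_, by rw [hk], by simp [hk, s], hc⟩
  · rw [hagree i (by simp), Function.update_of_ne hki.symm]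
  · rw [hagree j (by simp), Function.update_of_ne hkj.symm]

/-- Priority comparisons are anonymous in the presence of a third individual: if `k` ranks `x`
where `i` does and her score compares to that of `j` as that of `i` does, then `j` keeps over `k`
the advantage she has over `i`. -/
lemma TauAdmissible.gt_of_replace (hτ : TauAdmissible N τ) (hθ : θ ∈ prioΘS N)
    {θ' : Fin N → PrioReport N} (hθ' : θ' ∈ prioΘS N) {i j k x : Fin N}
    (hki : k ≠ i) (hkj : k ≠ j) (hj : θ' j = θ j)
    (hpos : position (θ' k).1 x = position (θ i).1 x)
    (hside : (θ' k).2 x < (θ j).2 x ↔ (θ i).2 x < (θ j).2 x)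
    (hgt : τ θ j x > τ θ i x) : τ θ' j x > τ θ' k x := by
  obtain ⟨v, hv, hvj, hvside⟩ := exists_between_side (-(θ i).2 x) (-(θ j).2 x)
  have hij : i ≠ j := by
    rintro rfl
    exact lt_irrefl _ hgt
  have hrij := hθ.2 i j x hij
  have hvlt : -v < (θ i).2 x := by linarith
  have hvj' : -v ≠ (θ j).2 x := fun h => hvj (by linarith)
  have hvside' : -v < (θ j).2 x ↔ (θ i).2 x < (θ j).2 x := by
    have h1 : (θ j).2 x < -v ↔ (θ j).2 x < (θ i).2 x := by
      constructor <;> intro h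
      · exact neg_lt_neg_iff.1 (hvside.1 (by linarith))
      · linarith [hvside.2 (neg_lt_neg h)]
    constructor <;> intro h
    · by_contra hcon
      exact lt_asymm h (h1.2 (lt_of_le_of_ne (not_lt.1 hcon) hrij.symm))
    · exact hvlt.trans h
  obtain ⟨θ'', hθ'', hi'', hj'', hQ, hv'', -⟩ := exists_replace hθ Function.injective_id hki hkj
    (hθ'.1 k) hvlt.ne hvj'
  have hji : τ θ'' j x > τ θ'' i x :=
    (hτ.iia θ hθ θ'' hθ'' j i x (by rw [hj'']) (by rw [hi'']) (by rw [hi'', hj''])).1 hgt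
  have hik : τ θ'' i x > τ θ'' k x := by
    refine hτ.equalTreatment θ'' hθ'' i k x (by rw [hi'', hQ, hpos]) ?_
    rw [hi'', hv'']
    exact hvlt
  refine (hτ.iia θ'' hθ'' θ' hθ' j k x (by rw [hj'', hj]) (by rw [hQ]) ?_).1 (hik.trans hji)
  rw [hj'', hv'', hj]
  exact hvside'.trans hside.symm

lemma position_swap {Q : Fin N → Fin N → Prop} (hQ : IsStrictTotalOrder (Fin N) Q)
    {a b o : Fin N} (ha : Q b a) (ho : Q b o) :
    position (fun x y => Q (Equiv.swap a o x) (Equiv.swap a o y)) b = position Q b := by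
  have hba : b ≠ a := by
    rintro rfl
    exact hQ.not_rel_self _ ha
  have hbo : b ≠ o := by
    rintro rfl
    exact hQ.not_rel_self _ ho
  have hset : {x | Q (Equiv.swap a o x) (Equiv.swap a o b)} = {x | Q x b} := by
    ext x
    rw [Set.mem_ofPred_eq, Set.mem_ofPred_eq, Equiv.swap_apply_of_ne_of_ne hba hbo]
    rcases eq_or_ne x a with rfl | hxa
    · simp [hQ.not_rel_symm ha, hQ.not_rel_symm ho]
    rcases eq_or_ne x o with rfl | hxo
    · simp [hQ.not_rel_symm ha, hQ.not_rel_symm ho]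
    · rw [Equiv.swap_apply_of_ne_of_ne hxa hxo]
  rw [position, position, hset]

/-- A third individual whose `ω`-object is worse for both `i` and `j` can block their exchange. -/
lemma DARepresentable.exists_triple (hφ : DARepresentable φ τ) (hθ : θ ∈ prioΘS N)
    (hω : Function.Bijective ω) (hs : StableAt (fun i => (θ i).1) (τ θ) ω) {i j k : Fin N}
    (hki : k ≠ i) (hkj : k ≠ j) (hij : (θ i).1 (ω j) (ω i)) (hji : (θ j).1 (ω i) (ω j))
    (hik : (θ i).1 (ω i) (ω k)) (hjk : (θ j).1 (ω j) (ω k)) :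
    ∃ θ' ∈ prioΘS N, θ' i = θ i ∧ θ' j = θ j ∧ φ θ' i = ω i ∧ φ θ' j = ω j := by
  have hne : i ≠ j := by
    rintro rfl
    exact (hθ.1 _).not_rel_self _ hij
  have hijk : (θ i).1 (ω j) (ω k) := (hθ.1 i).trans _ _ _ hij hik
  have hgt : τ θ j (ω j) > τ θ i (ω j) :=
    lt_of_le_of_ne (not_lt.1 fun h => hs ⟨i, j, ω j, hij, rfl, h⟩)
      (hφ.ne_of_common_worse hθ hne hijk hjk)
  obtain ⟨v, hv, hvj, hside⟩ := exists_between_side ((θ i).2 (ω j)) ((θ j).2 (ω j))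
  have hQ : IsStrictTotalOrder (Fin N)
      (fun x y => (θ i).1 (Equiv.swap (ω i) (ω k) x) (Equiv.swap (ω i) (ω k) y)) :=
    have := hθ.1 i
    (Equiv.swap (ω i) (ω k)).injective.isStrictTotalOrder_onFun (r := (θ i).1)
  obtain ⟨θ', hθ', hi', hj', hk', hkv, hc⟩ :=
    exists_replace hθ hω.injective hki hkj hQ hv.ne' hvj
  have hpos : position (θ' k).1 (ω j) = position (θ i).1 (ω j) := by
    rw [hk']
    exact position_swap (hθ.1 i) hij hijk
  have hjk_gt : τ θ' j (ω j) > τ θ' k (ω j) :=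
    hφ.1.gt_of_replace hθ hθ' hki hkj hj' hpos (by rw [hkv]; exact hside) hgt
  have hki_gt : τ θ' k (ω j) > τ θ' i (ω j) :=
    hφ.1.equalTreatment θ' hθ' k i (ω j) (by rw [hpos, hi']) (by rw [hkv, hi']; exact hv)
  have hswap : Equiv.swap (ω i) (ω k) (ω j) = ω j :=
    Equiv.swap_apply_of_ne_of_ne (fun h => hne (hω.injective h).symm)
      (fun h => hkj (hω.injective h).symm)
  have hki_pref : ¬ (θ' k).1 (ω i) (ω k) := by
    rw [hk']
    simpa using (hθ.1 i).not_rel_symm hik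
  have hkj_pref : (θ' k).1 (ω j) (ω k) := by
    rw [hk']
    simpa [hswap] using hij
  have hs' : StableAt (fun i => (θ' i).1) (τ θ') ω := by
    refine hc.stableAt hφ.1 hθ' fun a ha b hb hP => ?_
    simp only [Finset.mem_insert, Finset.mem_singleton] at ha hb
    rcases eq_or_ne a b with rfl | hab
    · exact lt_irrefl _
    rcases hb with rfl | rfl | rfl
    · rcases ha with rfl | rfl | rfl
      · exact absurd rfl hab
      · intro h
        refine hs ⟨a, b, ω b, hji, rfl, ?_⟩
        exact (hφ.1.iia θ' hθ' θ hθ a b (ω b) (by rw [hj']) (by rw [hi'])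
          (by rw [hi', hj'])).1 h
      · exact absurd hP hki_pref
    · rcases ha with rfl | rfl | rfl
      · exact lt_asymm (hki_gt.trans hjk_gt)
      · exact absurd rfl hab
      · exact lt_asymm hjk_gt
    · rcases ha with rfl | rfl | rfl
      · rw [hi'] at hP
        exact absurd hP ((hθ.1 _).not_rel_symm hik)
      · rw [hj'] at hP
        exact absurd hP ((hθ.1 _).not_rel_symm hjk)
      · exact absurd rfl hab
  obtain ⟨hbij, hstab, hopt⟩ := hφ.2 θ' hθ'
  have hmem : ∀ a, a = i ∨ a = j ∨ a = k → φ θ' a = ω i ∨ φ θ' a = ω j ∨ φ θ' a = ω k := by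
    intro a ha
    obtain ⟨l, hl⟩ := hω.surjective (φ θ' a)
    by_cases hlG : l ∈ ({i, j, k} : Finset (Fin N))
    · simp only [Finset.mem_insert, Finset.mem_singleton] at hlG
      rcases hlG with rfl | rfl | rfl <;> simp [← hl]
    · have := hbij.injective ((hφ.apply_eq_of_claimsOutside hθ' hc hlG).trans hl)
      exact absurd (by simpa [this] using ha) hlG
  have hoi := hopt ω hω hs' i
  have hoj := hopt ω hω hs' j
  have hok := hopt ω hω hs' k
  simp only [hi', hj'] at hoi hoj
  have hφi : φ θ' i = ω i ∨ φ θ' i = ω j := by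
    rcases hmem i (by simp) with h | h | h
    · exact Or.inl h
    · exact Or.inr h
    · rw [h] at hoi
      exact absurd (hoi.resolve_left fun h => hki (hω.injective h))
        ((hθ.1 i).not_rel_symm hik)
  have hφj : φ θ' j = ω i ∨ φ θ' j = ω j := by
    rcases hmem j (by simp) with h | h | h
    · exact Or.inl h
    · exact Or.inr h
    · rw [h] at hoj
      exact absurd (hoj.resolve_left fun h => hkj (hω.injective h))
        ((hθ.1 j).not_rel_symm hjk)
  have hdiff : φ θ' i ≠ φ θ' j := fun h => hne (hbij.injective h)
  have hφk : φ θ' k = ω k := by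
    have h1 : φ θ' k ≠ φ θ' i := fun h => hki (hbij.injective h)
    have h2 : φ θ' k ≠ φ θ' j := fun h => hkj (hbij.injective h)
    have h3 := hmem k (by simp)
    rcases hφi with h | h <;> rcases hφj with h' | h' <;> simp_all
  refine ⟨θ', hθ', hi', hj', ?_⟩
  have hφi' : φ θ' i = ω i := by
    refine hφi.resolve_right fun h => hstab ⟨k, i, ω j, ?_, h, hki_gt⟩
    rwa [hφk]
  exact ⟨hφi', hφj.resolve_left fun h => hdiff (hφi'.trans h.symm)⟩

lemma DARepresentable.detects_pair_of_blocks (hφ : DARepresentable φ τ) (hθ : θ ∈ prioΘS N)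
    {i j : Fin N} (hP : (θ i).1 (ω j) (ω i)) (hgt : τ θ i (ω j) > τ θ j (ω j)) :
    Detects (prioΘS N) φ θ ω {i, j} := by
  refine ⟨by simp, fun θ' hθ' hagree => ?_⟩
  by_contra! hcon
  have hi' : θ' i = θ i := hagree i (by simp)
  have hj' : θ' j = θ j := hagree j (by simp)
  refine (hφ.2 θ' hθ').2.1 ⟨i, j, ω j, ?_, (hcon j (by simp)).symm, ?_⟩
  · simpa only [← hcon i (by simp), hi'] using hP
  · exact (hφ.1.iia θ hθ θ' hθ' i j (ω j) (by rw [hi']) (by rw [hj']) (by rw [hi', hj'])).1 hgt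

lemma DARepresentable.detects_pair_of_envy [NeZero N] (hφ : DARepresentable φ τ) {i j : Fin N}
    (hij : (θ i).1 (ω j) (ω i)) (hji : (θ j).1 (ω i) (ω j))
    (hall : ∀ o, o ≠ ω i → o ≠ ω j → ((θ i).1 o (ω i) ∨ (θ j).1 o (ω j))) :
    Detects (prioΘS N) φ θ ω {i, j} := by
  refine ⟨by simp, fun θ' hθ' hagree => ?_⟩
  by_contra! hcon
  have hi' : θ' i = θ i := hagree i (by simp)
  have hj' : θ' j = θ j := hagree j (by simp)
  obtain ⟨o, ho⟩ := (hφ.2 θ' hθ').exists_unenvied hθ'.1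
  have hoi := ho i
  have hoj := ho j
  rw [← hcon i (by simp), hi'] at hoi
  rw [← hcon j (by simp), hj'] at hoj
  by_cases h1 : o = ω i
  · exact hoj (h1 ▸ hji)
  by_cases h2 : o = ω j
  · exact hoi (h2 ▸ hij)
  exact (hall o h1 h2).elim hoi hoj

/-- The converse of `DARepresentable.detects_pair_of_envy` at stable outcomes. -/
lemma DARepresentable.envy_of_detects_pair (hφ : DARepresentable φ τ) (hθ : θ ∈ prioΘS N)
    (hω : Function.Bijective ω) (hs : StableAt (fun i => (θ i).1) (τ θ) ω) {i j : Fin N}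
    (hne : i ≠ j) (hdet : Detects (prioΘS N) φ θ ω {i, j}) :
    (θ i).1 (ω j) (ω i) ∧ (θ j).1 (ω i) (ω j) ∧
      ∀ o, o ≠ ω i → o ≠ ω j → ((θ i).1 o (ω i) ∨ (θ j).1 o (ω j)) := by
  have hundet : ∀ θ' ∈ prioΘS N, θ' i = θ i → θ' j = θ j → φ θ' i = ω i → φ θ' j ≠ ω j := by
    intro θ' hθ' hi' hj' hφi hφj
    obtain ⟨a, ha, hωa⟩ := hdet.2 θ' hθ' (by simp [hi', hj'])
    simp only [Finset.mem_insert, Finset.mem_singleton] at ha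
    rcases ha with rfl | rfl
    · exact hωa hφi.symm
    · exact hωa hφj.symm
  have hωne : ω i ≠ ω j := fun h => hne (hω.injective h)
  have hij : (θ i).1 (ω j) (ω i) := by
    refine ((hθ.1 i).rel_or_rel hωne).resolve_left fun h => ?_
    obtain ⟨θ', hθ', hi', hj', hφ'⟩ := hφ.exists_pair hθ hω hs hne h
    exact hundet θ' hθ' hi' hj' (congrFun hφ' i) (congrFun hφ' j)
  have hji : (θ j).1 (ω i) (ω j) := by
    refine ((hθ.1 j).rel_or_rel hωne).resolve_right fun h => ?_
    obtain ⟨θ', hθ', hj', hi', hφ'⟩ := hφ.exists_pair hθ hω hs hne.symm h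
    exact hundet θ' hθ' hi' hj' (congrFun hφ' i) (congrFun hφ' j)
  refine ⟨hij, hji, fun o hoi hoj => ?_⟩
  by_contra! hcon
  obtain ⟨k, rfl⟩ := hω.surjective o
  obtain ⟨θ', hθ', hi', hj', hφi, hφj⟩ := hφ.exists_triple hθ hω hs (k := k)
    (fun h => hoi (h ▸ rfl)) (fun h => hoj (h ▸ rfl)) hij hji
    (((hθ.1 i).rel_or_rel hoi).resolve_left hcon.1)
    (((hθ.1 j).rel_or_rel hoj).resolve_left hcon.2)
  exact hundet θ' hθ' hi' hj' hφi hφj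

end PriorityBased

/-- Theorem 2.1: let `φ` be DA-representable through `τ` and let
`θ = (P, r)` be a problem. Then `#φ^θ = 2` iff every feasible deviation `ω ≠ φ θ` is
either not stable at `(P, τ θ)`, or stable at `(P, τ θ)` and there are individuals
`i, j` with (a) `ω(j) P_i ω(i)` and `ω(i) P_j ω(j)`, and (b) every object
`o ∉ {ω(i), ω(j)}` satisfies `o P_i ω(i)` or `o P_j ω(j)`. -/
theorem statement3 {N : ℕ} (hN : 2 ≤ N)
    (φ : (Fin N → PrioReport N) → (Fin N → Fin N))
    (τ : (Fin N → PrioReport N) → (Fin N → Fin N → ℝ))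
    (hφ : DARepresentable φ τ)
    (θ : Fin N → PrioReport N) (hθ : θ ∈ prioΘS N) :
    auditIndex (allocΩS N) (prioΘS N) φ θ = 2 ↔
      TwoDetectableCond (fun i => (θ i).1) (τ θ) (φ θ) := by
  have : NeZero N := ⟨by omega⟩
  have hbij := (hφ.2 θ hθ).1
  have hne : ∃ ω ∈ allocΩS N, ω ≠ φ θ := by
    let x : Fin N := ⟨0, by omega⟩
    let y : Fin N := ⟨1, by omega⟩
    have hxy : x ≠ y := by simp [x, y]
    refine ⟨_, hbij.comp (Equiv.swap x y).bijective, fun h => hxy ?_⟩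
    have := congrFun h x
    rw [Function.comp_apply, Equiv.swap_apply_left] at this
    exact (hbij.injective this).symm
  rw [auditIndex_eq_two_iff hne fun ω hω i => hφ.not_detects_singleton hθ hω i]
  constructor
  · intro h ω hω hωφ
    by_cases hs : StableAt (fun i => (θ i).1) (τ θ) ω
    · obtain ⟨G, hG, hdet⟩ := h ω hω hωφ
      obtain ⟨i, j, hij, rfl⟩ := Finset.card_eq_two.1 hG
      exact Or.inr ⟨hs, i, j, hij, hφ.envy_of_detects_pair hθ hω hs hij hdet⟩
    · exact Or.inl hs
  · intro h ω hω hωφ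
    rcases h ω hω hωφ with hs | ⟨-, i, j, hij, h1, h2, h3⟩
    · obtain ⟨i, j, o, hP, rfl, hgt⟩ := not_not.1 hs
      refine ⟨{i, j}, Finset.card_pair ?_, hφ.detects_pair_of_blocks hθ hP hgt⟩
      rintro rfl
      exact lt_irrefl _ hgt
    · exact ⟨{i, j}, Finset.card_pair hij, hφ.detects_pair_of_envy h1 h2 h3⟩
end

section
/- Let N ≥ 4. Then there exists a sequential dictatorship φ in the house allocation setting whose worst-case auditability index satisfies #φ ≥ N − 1. -/
/-! ## House allocation and sequential dictatorships -/

section HouseAlloc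

variable {N : ℕ}

/-- Feasible problems in the house allocation model: each type report is a strict
preference (strict total order) over the `N` objects. -/
def houseΘS (N : ℕ) : Set (Fin N → (Fin N → Fin N → Prop)) :=
  {θ | ∀ i, IsStrictTotalOrder (Fin N) (θ i)}

/-- A suboutcome, encoded as a partial assignment of objects to individuals
(`none` = unassigned). -/
abbrev Suboutcome (N : ℕ) := Fin N → Option (Fin N)

/-- A suboutcome is a partial bijection. -/
def PartialInj (σ : Suboutcome N) : Prop :=
  ∀ i j o, σ i = some o → σ j = some o → i = j

/-- The unassigned individuals `Ī(σ)` of a suboutcome. -/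
def unassignedI (σ : Suboutcome N) : Set (Fin N) := {i | σ i = none}

/-- The unassigned objects `Ō(σ)` of a suboutcome. -/
def unassignedO (σ : Suboutcome N) : Set (Fin N) := {o | ∀ i, σ i ≠ some o}

/-- A dictatorial structure: a map from suboutcomes to individuals picking an
unassigned individual at every (partially bijective) incomplete suboutcome. -/
def DictStruct (π : Suboutcome N → Fin N) : Prop :=
  ∀ σ : Suboutcome N, PartialInj σ → (∃ i, σ i = none) → σ (π σ) = none

open Classical in
/-- The suboutcome obtained by restricting the outcome `ω` to the individuals in `I`. -/
noncomputable def subOf (ω : Fin N → Fin N) (I : Set (Fin N)) : Suboutcome N :=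
  fun i => if i ∈ I then some (ω i) else none

/-- `σord` is the (ordered) run of the sequential dictatorship with dictatorial
structure `π` at problem `θ` producing the outcome `ω`: at each step `t`, the
individual `σord t` is the dictator chosen by `π` at the suboutcome formed by the
assignments of the previous steps, and she receives her most `θ`-preferred object
among those not assigned at previous steps. -/
def IsRun (π : Suboutcome N → Fin N) (θ : Fin N → (Fin N → Fin N → Prop))
    (ω : Fin N → Fin N) (σord : Fin N → Fin N) : Prop :=
  Function.Bijective σord ∧
    ∀ t : Fin N,
      σord t = π (subOf ω {i | ∃ s : Fin N, s < t ∧ σord s = i}) ∧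
      ∀ o, (∀ s : Fin N, s < t → ω (σord s) ≠ o) → o ≠ ω (σord t) →
        θ (σord t) (ω (σord t)) o

/-- `φ` is the sequential dictatorship induced by the dictatorial structure `π`. -/
def IsSeqDict (π : Suboutcome N → Fin N)
    (φ : (Fin N → (Fin N → Fin N → Prop)) → (Fin N → Fin N)) : Prop :=
  DictStruct π ∧
    ∀ θ ∈ houseΘS N, Function.Bijective (φ θ) ∧ ∃ σord, IsRun π θ (φ θ) σord

/-- `I_t^φ` (for `t ∈ {1, …, N}`): the set of individuals who are the step-`t`
dictator for at least one problem. -/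
def IstepSet (π : Suboutcome N → Fin N)
    (φ : (Fin N → (Fin N → Fin N → Prop)) → (Fin N → Fin N)) (t : ℕ) :
    Set (Fin N) :=
  {i | ∃ θ ∈ houseΘS N, ∃ σord, IsRun π θ (φ θ) σord ∧
    ∃ h : t - 1 < N, σord ⟨t - 1, h⟩ = i}

/-- `S^φ`: the set of suboutcomes that can arise at some step of the sequential
dictatorship algorithm at some problem. -/
def SPhi (π : Suboutcome N → Fin N)
    (φ : (Fin N → (Fin N → Fin N → Prop)) → (Fin N → Fin N)) :
    Set (Suboutcome N) :=
  {s | ∃ θ ∈ houseΘS N, ∃ σord, IsRun π θ (φ θ) σord ∧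
    ∃ t : ℕ, t ≤ N ∧ s = subOf (φ θ) {i | ∃ u : Fin N, (u : ℕ) < t ∧ σord u = i}}

/-- `φ` (a sequential dictatorship with dictatorial structure `π`) is a
vice dictatorship: (1) `I_t^φ` is a singleton for each `t ∈ {4, …, N−2}`;
(2) `|I_2^φ ∪ I_3^φ| ≤ 2`; (3) for any two reachable suboutcomes with the same
unassigned objects and unassigned individuals, the dictator is the same. -/
def ViceDict (π : Suboutcome N → Fin N)
    (φ : (Fin N → (Fin N → Fin N → Prop)) → (Fin N → Fin N)) : Prop :=
  (∀ t : ℕ, 4 ≤ t → t ≤ N - 2 → ∃ i, IstepSet π φ t = {i}) ∧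
  (IstepSet π φ 2 ∪ IstepSet π φ 3).ncard ≤ 2 ∧
  (∀ s ∈ SPhi π φ, ∀ s' ∈ SPhi π φ,
    unassignedO s = unassignedO s' → unassignedI s = unassignedI s' → π s = π s')

end HouseAlloc

/-! ### Existence of runs -/

/-- A nonempty set of objects has a best element for a strict preference. -/
lemma exists_best {N : ℕ} (r : Fin N → Fin N → Prop) [IsStrictTotalOrder (Fin N) r]
    (S : Set (Fin N)) (hS : S.Nonempty) : ∃ b ∈ S, ∀ o ∈ S, o ≠ b → r b o := by
  have wf : WellFounded r := Finite.wellFounded_of_trans_of_irrefl r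
  refine ⟨wf.min S hS, wf.min_mem S hS, fun o ho hne => ?_⟩
  rcases trichotomous_of r (wf.min S hS) o with h | h | h
  · exact h
  · exact absurd h.symm hne
  · exact absurd h (wf.not_lt_min S ho)

lemma exists_forall_lt_ne {N : ℕ} (f : Fin N → Fin N) (T : Fin N) :
    ∃ i, ∀ u < T, f u ≠ i := by
  by_contra! h
  have h1 : (Finset.univ : Finset (Fin N)) ⊆ (Finset.Iio T).image f := by
    intro i _
    obtain ⟨u, hu, hi⟩ := h i
    exact Finset.mem_image.2 ⟨u, Finset.mem_Iio.2 hu, hi⟩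
  have h2 := (Finset.card_le_card h1).trans Finset.card_image_le
  simp only [Finset.card_univ, Fintype.card_fin, Fin.card_Iio] at h2
  have := T.isLt
  omega

lemma subOf_congr {N : ℕ} {g g' : Fin N → Fin N} {I I' : Set (Fin N)} (hI : I = I')
    (h : ∀ i ∈ I, g i = g' i) : subOf g I = subOf g' I' := by
  subst hI
  funext i
  by_cases hi : i ∈ I <;> simp [subOf, hi, h]

lemma exists_partial_run {N : ℕ} {π : Suboutcome N → Fin N} (hπ : DictStruct π)
    {θ : Fin N → (Fin N → Fin N → Prop)} (hθ : θ ∈ houseΘS N) (t : ℕ) (ht : t ≤ N) :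
    ∃ f g : Fin N → Fin N,
      (∀ s s' : Fin N, (s : ℕ) < t → (s' : ℕ) < t → f s = f s' → s = s') ∧
      (∀ s s' : Fin N, (s : ℕ) < t → (s' : ℕ) < t → g (f s) = g (f s') → s = s') ∧
      ∀ s : Fin N, (s : ℕ) < t →
        f s = π (subOf g {i | ∃ u : Fin N, u < s ∧ f u = i}) ∧
        ∀ o, (∀ u : Fin N, u < s → g (f u) ≠ o) → o ≠ g (f s) → θ (f s) (g (f s)) o := by
  induction t with
  | zero => exact ⟨id, id, by simp, by simp, by simp⟩
  | succ t ih =>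
    obtain ⟨f, g, hf, hg, hrun⟩ := ih (by omega)
    let T : Fin N := ⟨t, ht⟩
    have hT : ∀ s : Fin N, s < T ↔ (s : ℕ) < t := fun s => Iff.rfl
    let I : Set (Fin N) := {i | ∃ u : Fin N, u < T ∧ f u = i}
    obtain ⟨d, hd⟩ : ∃ d, d = π (subOf g I) := ⟨_, rfl⟩
    have hdI : d ∉ I := by
      have h1 : PartialInj (subOf g I) := by
        intro i j o hi hj
        by_cases hiI : i ∈ I
        · by_cases hjI : j ∈ I
          · simp only [subOf, hiI, hjI, if_true, Option.some.injEq] at hi hj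
            obtain ⟨u, hu, rfl⟩ := hiI
            obtain ⟨v, hv, rfl⟩ := hjI
            rw [hg u v hu hv (hi.trans hj.symm)]
          · simp [subOf, hjI] at hj
        · simp [subOf, hiI] at hi
      have h2 : ∃ i, subOf g I i = none := by
        obtain ⟨i, hi⟩ := exists_forall_lt_ne f T
        refine ⟨i, ?_⟩
        have : i ∉ I := fun ⟨u, hu, h⟩ => hi u hu h
        simp [subOf, this]
      have h3 := hπ _ h1 h2
      rw [← hd] at h3
      intro h
      simp [subOf, h] at h3
    have hfd : ∀ u : Fin N, (u : ℕ) < t → f u ≠ d := fun u hu h => hdI ⟨u, hu, h⟩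
    have := hθ d
    obtain ⟨b, hb, hbest⟩ := exists_best (θ d) {o | ∀ u < T, g (f u) ≠ o}
      (exists_forall_lt_ne (g ∘ f) T)
    have hf' : ∀ u : Fin N, (u : ℕ) < t → Function.update f T d u = f u := fun u hu =>
      Function.update_of_ne (fun h => by subst h; exact lt_irrefl _ hu) _ _
    have hfT : Function.update f T d T = d := Function.update_self ..
    have hg' : ∀ u : Fin N, (u : ℕ) < t → Function.update g d b (f u) = g (f u) := fun u hu =>
      Function.update_of_ne (hfd u hu) _ _
    have hgd : Function.update g d b d = b := Function.update_self ..
    have hlt : ∀ s : Fin N, (s : ℕ) < t + 1 → (s : ℕ) < t ∨ s = T := fun s hs => by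
      rcases Nat.lt_succ_iff_lt_or_eq.1 hs with h | h
      · exact Or.inl h
      · exact Or.inr (Fin.ext h)
    have hset : ∀ s : Fin N, (s : ℕ) ≤ t →
        {i | ∃ u : Fin N, u < s ∧ f u = i} =
          {i | ∃ u : Fin N, u < s ∧ Function.update f T d u = i} := by
      intro s hs
      ext i
      refine exists_congr fun u => and_congr_right fun hu => ?_
      rw [hf' u (lt_of_lt_of_le hu hs)]
    have hsub : ∀ s : Fin N, (s : ℕ) ≤ t →
        subOf g {i | ∃ u : Fin N, u < s ∧ f u = i} =
          subOf (Function.update g d b)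
            {i | ∃ u : Fin N, u < s ∧ Function.update f T d u = i} := by
      intro s hs
      refine subOf_congr (hset s hs) ?_
      rintro i ⟨u, hu, rfl⟩
      exact (hg' u (lt_of_lt_of_le hu hs)).symm
    refine ⟨Function.update f T d, Function.update g d b, ?_, ?_, ?_⟩
    · intro s s' hs hs' h
      rcases hlt s hs with hs | rfl <;> rcases hlt s' hs' with hs' | rfl
      · rw [hf' s hs, hf' s' hs'] at h
        exact hf s s' hs hs' h
      · rw [hf' s hs, hfT] at h
        exact absurd h (hfd s hs)
      · rw [hf' s' hs', hfT] at h
        exact absurd h.symm (hfd s' hs')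
      · rfl
    · intro s s' hs hs' h
      rcases hlt s hs with hs | rfl <;> rcases hlt s' hs' with hs' | rfl
      · rw [hf' s hs, hf' s' hs', hg' s hs, hg' s' hs'] at h
        exact hg s s' hs hs' h
      · rw [hf' s hs, hfT, hg' s hs, hgd] at h
        exact absurd h (hb s hs)
      · rw [hf' s' hs', hfT, hg' s' hs', hgd] at h
        exact absurd h.symm (hb s' hs')
      · rfl
    · intro s hs
      rcases hlt s hs with hs | rfl
      · rw [← hsub s hs.le, hf' s hs, hg' s hs]
        refine ⟨(hrun s hs).1, fun o ho => (hrun s hs).2 o fun u hu => ?_⟩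
        have hut : (u : ℕ) < t := lt_trans (Fin.lt_def.1 hu) hs
        have := ho u hu
        rwa [hf' u hut, hg' u hut] at this
      · rw [← hsub T le_rfl, hfT, hgd]
        refine ⟨hd, fun o ho => hbest o fun u hu => ?_⟩
        have := ho u hu
        rwa [hf' u hu, hg' u hu] at this

/-- Every dictatorial structure has a run at every problem. -/
lemma exists_isRun {N : ℕ} {π : Suboutcome N → Fin N} (hπ : DictStruct π)
    {θ : Fin N → (Fin N → Fin N → Prop)} (hθ : θ ∈ houseΘS N) :
    ∃ ω : Fin N → Fin N, Function.Bijective ω ∧ ∃ σord, IsRun π θ ω σord := by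
  obtain ⟨f, g, hf, hg, hrun⟩ := exists_partial_run hπ hθ N le_rfl
  have hfb : Function.Bijective f :=
    Finite.injective_iff_bijective.1 fun s s' h => hf s s' s.isLt s'.isLt h
  refine ⟨g, Finite.injective_iff_bijective.1 fun a b h => ?_, f, hfb,
    fun s => hrun s s.isLt⟩
  obtain ⟨s, rfl⟩ := hfb.2 a
  obtain ⟨v, rfl⟩ := hfb.2 b
  rw [hg s v s.isLt v.isLt h]

/-! ### Bounds on the auditability indices -/

section IndexBounds

variable {ι : Type*} [Fintype ι] {Θi : ι → Type*} {Ωi : ι → Type*}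

lemma minDetect_le_card_s8 (ΘS : Set (∀ i, Θi i)) (φ : (∀ i, Θi i) → (∀ i, Ωi i))
    (θ : ∀ i, Θi i) (ω : ∀ i, Ωi i) : minDetect ΘS φ θ ω ≤ Fintype.card ι := by
  rcases Set.eq_empty_or_nonempty {n | ∃ G : Finset ι, G.card = n ∧ Detects ΘS φ θ ω G} with h | h
  · simp [minDetect, h]
  · obtain ⟨G, hG, -⟩ := Nat.sInf_mem h
    exact hG.symm.le.trans (Finset.card_le_univ G)

lemma auditIndex_le_card (ΩS : Set (∀ i, Ωi i)) (ΘS : Set (∀ i, Θi i))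
    (φ : (∀ i, Θi i) → (∀ i, Ωi i)) (θ : ∀ i, Θi i) :
    auditIndex ΩS ΘS φ θ ≤ Fintype.card ι := by
  refine csSup_le' ?_
  rintro n ⟨ω, -, -, rfl⟩
  exact minDetect_le_card_s8 ΘS φ θ ω

lemma minDetect_le_worstIndex {ΩS : Set (∀ i, Ωi i)} {ΘS : Set (∀ i, Θi i)}
    {φ : (∀ i, Θi i) → (∀ i, Ωi i)} {θ : ∀ i, Θi i} {ω : ∀ i, Ωi i}
    (hθ : θ ∈ ΘS) (hω : ω ∈ ΩS) (hne : ω ≠ φ θ) :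
    minDetect ΘS φ θ ω ≤ worstIndex ΩS ΘS φ := by
  have h1 : minDetect ΘS φ θ ω ≤ auditIndex ΩS ΘS φ θ := by
    refine le_csSup ⟨Fintype.card ι, ?_⟩ ⟨ω, hω, hne, rfl⟩
    rintro n ⟨ω', -, -, rfl⟩
    exact minDetect_le_card_s8 ΘS φ θ ω'
  refine h1.trans (le_csSup ⟨Fintype.card ι, ?_⟩ ⟨θ, hθ, rfl⟩)
  rintro n ⟨η, -, rfl⟩
  exact auditIndex_le_card ΩS ΘS φ η

/-- If every group missing two individuals fails to detect `ω`, then `ω` requires a group of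
at least `card ι - 1` individuals. -/
lemma card_sub_one_le_minDetect [DecidableEq ι] {ΘS : Set (∀ i, Θi i)} {φ : (∀ i, Θi i) → (∀ i, Ωi i)}
    {θ : ∀ i, Θi i} {ω : ∀ i, Ωi i} (hne : ω ≠ φ θ)
    (h : ∀ i j, i ≠ j → ∃ θ' ∈ ΘS, ∀ k, k ≠ i → k ≠ j → θ' k = θ k ∧ ω k = φ θ' k) :
    Fintype.card ι - 1 ≤ minDetect ΘS φ θ ω := by
  have hdet : Detects ΘS φ θ ω Finset.univ := by
    obtain ⟨i, hi⟩ := Function.ne_iff.1 hne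
    refine ⟨⟨i, Finset.mem_univ i⟩, fun θ' _ h' => ⟨i, Finset.mem_univ i, ?_⟩⟩
    rwa [show θ' = θ from funext fun k => h' k (Finset.mem_univ k)]
  obtain ⟨G, hG, -, hGdet⟩ := Nat.sInf_mem
    (s := {n | ∃ G : Finset ι, G.card = n ∧ Detects ΘS φ θ ω G}) ⟨_, _, rfl, hdet⟩
  change G.card = minDetect ΘS φ θ ω at hG
  by_contra! hlt
  rw [← hG] at hlt
  have hcard : 1 < Gᶜ.card := by
    rw [Finset.card_compl]
    omega
  obtain ⟨i, hi, j, hj, hij⟩ := Finset.one_lt_card.1 hcard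
  rw [Finset.mem_compl] at hi hj
  obtain ⟨θ', hθ', hk⟩ := h i j hij
  have hk' : ∀ k ∈ G, θ' k = θ k ∧ ω k = φ θ' k := fun k hkG =>
    hk k (fun e => hi (e ▸ hkG)) (fun e => hj (e ▸ hkG))
  obtain ⟨k, hkG, hkne⟩ := hGdet θ' hθ' fun k hkG => (hk' k hkG).1
  exact hkne (hk' k hkG).2

end IndexBounds

/-! ### Preferences -/

/-- The preference that ranks `a` first and the other objects in increasing order. -/
def prefTop {N : ℕ} (a : Fin N) : Fin N → Fin N → Prop :=
  fun x y => x ≠ y ∧ (x = a ∨ y ≠ a ∧ x < y)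

lemma isStrictTotalOrder_prefTop {N : ℕ} (a : Fin N) :
    IsStrictTotalOrder (Fin N) (prefTop a) where
  irrefl x h := h.1 rfl
  trans x y z := by
    unfold prefTop
    grind
  trichotomous x y := by
    unfold prefTop
    grind

lemma eq_of_prefTop {N : ℕ} {a b : Fin N} (h : a ≠ b → prefTop a b a) : b = a := by
  by_contra hne
  rcases (h (Ne.symm hne)).2 with h | h
  · exact hne h
  · exact h.1 rfl

/-! ### A dictatorial structure that is hard to audit -/

section Construction

variable {N : ℕ}

open Classical in
/-- Individuals dictate in increasing order, except that `l` dictates as soon as somebody has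
received an object other than her own. -/
noncomputable def vigilantDict (l : Fin N) (σ : Suboutcome N) : Fin N :=
  if σ l = none ∧ ∃ i o, σ i = some o ∧ o ≠ i then l
  else if h : ∃ i, σ i = none then
    (Finset.univ.filter fun i => σ i = none).min' (h.imp fun i hi => by simpa using hi)
  else l

lemma dictStruct_vigilantDict (l : Fin N) : DictStruct (vigilantDict l) := by
  intro σ _ h
  unfold vigilantDict
  split_ifs with h1
  · exact h1.1
  · exact (Finset.mem_filter.1 (Finset.min'_mem (Finset.univ.filter fun i => σ i = none)
      (h.imp fun i hi => by simpa using hi))).2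

lemma vigilantDict_eq_or (l : Fin N) (σ : Suboutcome N) (h : ∃ i, σ i = none) :
    (vigilantDict l σ = l ∧ σ l = none ∧ ∃ i o, σ i = some o ∧ o ≠ i) ∨
      ((σ l = none → ∀ i o, σ i = some o → o = i) ∧
        ∀ k < vigilantDict l σ, σ k ≠ none) := by
  by_cases h1 : σ l = none ∧ ∃ i o, σ i = some o ∧ o ≠ i
  · exact Or.inl ⟨by simp [vigilantDict, h1], h1⟩
  · refine Or.inr ⟨fun hl i o hi => by_contra fun hne => h1 ⟨hl, i, o, hi, hne⟩,
      fun k hk hkn => ?_⟩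
    rw [vigilantDict, if_neg h1, dif_pos h] at hk
    exact absurd (Finset.min'_le _ k (by simpa using hkn)) (not_le.2 hk)

/-- At each step of a run, either `l` dictates and somebody has already received an object other
than her own, or all individuals smaller than the dictator are assigned, and if `l` is unassigned
then all assigned individuals have received their own object. -/
lemma IsRun.vigilantDict_step {l : Fin N} {θ : Fin N → (Fin N → Fin N → Prop)}
    {ω σ : Fin N → Fin N} (h : IsRun (vigilantDict l) θ ω σ) (t : Fin N) :
    (σ t = l ∧ ∃ s < t, ω (σ s) ≠ σ s) ∨
      (((∀ s < t, σ s ≠ l) → ∀ s < t, ω (σ s) = σ s) ∧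
        ∀ k < σ t, ∃ s < t, σ s = k) := by
  have hnone : ∀ k, subOf ω {i | ∃ s : Fin N, s < t ∧ σ s = i} k = none ↔
      ∀ s < t, σ s ≠ k := by
    intro k
    simp [subOf]
  have hsome : ∀ k o, subOf ω {i | ∃ s : Fin N, s < t ∧ σ s = i} k = some o ↔
      (∃ s < t, σ s = k) ∧ ω k = o := by
    intro k o
    simp [subOf]
  have hex : ∃ i, subOf ω {i | ∃ s : Fin N, s < t ∧ σ s = i} i = none :=
    ⟨σ t, (hnone _).2 fun s hs e => hs.ne (h.1.1 e)⟩
  rcases vigilantDict_eq_or l _ hex with ⟨h1, -, i, o, hi, hne⟩ | ⟨h1, h2⟩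
  · obtain ⟨⟨s, hs, rfl⟩, rfl⟩ := (hsome _ _).1 hi
    exact Or.inl ⟨(h.2 t).1.trans h1, s, hs, hne⟩
  · refine Or.inr ⟨fun hl s hs => h1 ((hnone l).2 hl) _ _ ((hsome _ _).2 ⟨⟨s, hs, rfl⟩, rfl⟩),
      fun k hk => ?_⟩
    have := h2 k ((h.2 t).1 ▸ hk)
    rw [Ne, hnone] at this
    push Not at this
    exact this

/-- The problem at which the deviation is hard to detect: `p` ranks the objects in decreasing
order, and everybody else ranks her own object first. -/
def hardProblem (p : Fin N) (k : Fin N) : Fin N → Fin N → Prop :=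
  if k = p then (· > ·) else prefTop k

lemma hardProblem_mem (p : Fin N) : hardProblem p ∈ houseΘS N := by
  intro k
  unfold hardProblem
  split_ifs
  · infer_instance
  · exact isStrictTotalOrder_prefTop k

/-- If everybody's favourite objects are distinct, everybody receives her favourite object. -/
lemma IsRun.eq_of_prefTop {π : Suboutcome N → Fin N} {θ : Fin N → (Fin N → Fin N → Prop)}
    {ω σ τ : Fin N → Fin N} (h : IsRun π θ ω σ) (hτ : Function.Injective τ)
    (hθ : ∀ k, θ k = prefTop (τ k)) (k : Fin N) : ω k = τ k := by
  obtain ⟨t, rfl⟩ := h.1.2 k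
  induction t using WellFoundedLT.induction with
  | _ t ih =>
    refine _root_.eq_of_prefTop fun hne => hθ (σ t) ▸ (h.2 t).2 _ (fun s hs e => ?_) hne
    rw [ih s hs] at e
    exact hs.ne (h.1.1 (hτ e))

/-- In a problem where everybody but `p` ranks first the object prescribed by the transposition of
`i` and `j`, where `i` precedes `p`, everybody receives the prescribed object. -/
lemma IsRun.eq_swap {l p i j : Fin N} (hpl : ∀ k, p < k ↔ k = l)
    (hij : i ≠ j) (hip : i < p) (hjp : j ≠ p)
    {θ : Fin N → (Fin N → Fin N → Prop)} {ω σ : Fin N → Fin N}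
    (hω : Function.Injective ω) (h : IsRun (vigilantDict l) θ ω σ) (hθp : θ p = (· > ·))
    (hθ : ∀ k, k ≠ p → θ k = prefTop (Equiv.swap i j k)) (k : Fin N) :
    ω k = Equiv.swap i j k := by
  have hpl' : p < l := (hpl l).2 rfl
  obtain ⟨t, rfl⟩ := h.1.2 k
  induction t using WellFoundedLT.induction with
  | _ t ih =>
    have avail : ∀ s < t, ω (σ s) ≠ Equiv.swap i j (σ t) := fun s hs e => by
      rw [ih s hs] at e
      exact hs.ne (h.1.1 ((Equiv.swap i j).injective e))
    by_cases htp : σ t = p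
    · have hsp : Equiv.swap i j p = p := Equiv.swap_apply_of_ne_of_ne hip.ne' hjp.symm
      rw [htp, hsp] at avail ⊢
      have hbest := (h.2 t).2
      rw [htp, hθp] at hbest
      rcases h.vigilantDict_step t with ⟨h1, -⟩ | ⟨h1, h2⟩
      · exact absurd (htp.symm.trans h1) hpl'.ne
      · rw [htp] at h2
        obtain ⟨s, hs, hsi⟩ := h2 i hip
        have hωi : ω i = j := by
          rw [← hsi, ih s hs, hsi, Equiv.swap_apply_left]
        have hl : ∃ u < t, ω (σ u) = l := by
          by_cases hjl : j = l
          · exact ⟨s, hs, by rw [hsi, hωi, hjl]⟩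
          · have : ∃ u < t, σ u = l := by
              by_contra! hno
              have := h1 hno s hs
              rw [hsi, hωi] at this
              exact hij this.symm
            obtain ⟨u, hu, hul⟩ := this
            refine ⟨u, hu, ?_⟩
            rw [ih u hu, hul, Equiv.swap_apply_of_ne_of_ne (hip.trans hpl').ne' (Ne.symm hjl)]
        obtain ⟨u, hu, hul⟩ := hl
        by_contra hne
        have hgt : ω p > p := hbest p avail (Ne.symm hne)
        have hωp : ω p = l := (hpl _).1 hgt
        have hup : σ u = p := hω (hul.trans hωp.symm)
        exact hu.ne (h.1.1 (hup.trans htp.symm))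
    · refine _root_.eq_of_prefTop fun hne => hθ (σ t) htp ▸ (h.2 t).2 _ avail hne

/-- Under the identity outcome, `p` would be offered `l`, which she prefers to her own object. -/
lemma IsRun.ne_id {l p : Fin N} (hpl : p < l) {θ : Fin N → (Fin N → Fin N → Prop)}
    {ω σ : Fin N → Fin N} (h : IsRun (vigilantDict l) θ ω σ) (hθp : θ p = (· > ·)) :
    ω ≠ id := by
  rintro rfl
  obtain ⟨t, ht⟩ := h.1.2 p
  obtain ⟨u, hu⟩ := h.1.2 l
  have htu : t < u := by
    rcases h.vigilantDict_step u with ⟨-, s, -, hs⟩ | ⟨-, h2⟩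
    · exact absurd rfl hs
    · obtain ⟨s, hs, hsp⟩ := h2 p (hu ▸ hpl)
      rwa [← h.1.1 (hsp.trans ht.symm)]
  have hbest := (h.2 t).2 l (fun s hs e => by
    have := h.1.1 (e.trans hu.symm)
    exact absurd (this ▸ hs) htu.not_gt) (by simpa [ht] using hpl.ne')
  rw [ht, hθp] at hbest
  exact absurd hbest hpl.not_gt

end Construction

/-- Proposition 5: for `N ≥ 4` there exists a sequential dictatorship
`φ` in the house allocation setting whose worst-case auditability index is at least
`N − 1`. -/
theorem statement8 (N : ℕ) (hN : 4 ≤ N) :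
    ∃ (φ : (Fin N → (Fin N → Fin N → Prop)) → (Fin N → Fin N))
      (π : Suboutcome N → Fin N),
      IsSeqDict π φ ∧ N - 1 ≤ worstIndex (allocΩS N) (houseΘS N) φ := by
  let l : Fin N := ⟨N - 1, by omega⟩
  let p : Fin N := ⟨N - 2, by omega⟩
  have hpl : ∀ k : Fin N, p < k ↔ k = l := by
    intro k
    have := k.isLt
    simp only [Fin.lt_def, Fin.ext_iff, p, l]
    omega
  have hlp : p < l := (hpl l).2 rfl
  have : Nonempty (Fin N → Fin N) := ⟨id⟩
  choose! φ hφ using fun θ (hθ : θ ∈ houseΘS N) =>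
    exists_isRun (dictStruct_vigilantDict l) hθ
  refine ⟨φ, vigilantDict l, ⟨dictStruct_vigilantDict l, hφ⟩, ?_⟩
  have hne : (id : Fin N → Fin N) ≠ φ (hardProblem p) := by
    obtain ⟨σ, hσ⟩ := (hφ _ (hardProblem_mem p)).2
    exact (hσ.ne_id hlp (by simp [hardProblem])).symm
  refine le_trans ?_ (minDetect_le_worstIndex (hardProblem_mem p)
    (show id ∈ allocΩS N from Function.bijective_id) hne)
  have key := card_sub_one_le_minDetect (ΘS := houseΘS N) hne ?_
  · simpa using key
  have hlt : ∀ k : Fin N, k ≠ p → k ≠ l → k < p := fun k h1 h2 =>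
    lt_of_le_of_ne (not_lt.1 fun h => h2 ((hpl k).1 h)) h1
  have main : ∀ i j : Fin N, i ≠ j → (i = p ∨ i < p ∧ j ≠ p) → ∃ θ' ∈ houseΘS N,
      ∀ k, k ≠ i → k ≠ j → θ' k = hardProblem p k ∧ id k = φ θ' k := by
    rintro i j hij (rfl | ⟨hip, hjp⟩)
    · have hmem : (fun k : Fin N => prefTop k) ∈ houseΘS N := fun k =>
        isStrictTotalOrder_prefTop k
      refine ⟨_, hmem, fun k hk _ => ⟨by simp [hardProblem, hk], ?_⟩⟩
      obtain ⟨σ, hσ⟩ := (hφ _ hmem).2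
      exact (hσ.eq_of_prefTop (τ := id) Function.injective_id (fun _ => rfl) k).symm
    · let θ' : Fin N → (Fin N → Fin N → Prop) := fun k =>
        if k = p then (· > ·) else prefTop (Equiv.swap i j k)
      have hmem : θ' ∈ houseΘS N := by
        intro k
        simp only [θ']
        split_ifs
        · infer_instance
        · exact isStrictTotalOrder_prefTop _
      obtain ⟨σ, hσ⟩ := (hφ _ hmem).2
      refine ⟨θ', hmem, fun k hki hkj => ⟨?_, ?_⟩⟩
      · simp [θ', hardProblem, Equiv.swap_apply_of_ne_of_ne hki hkj]
      · rw [hσ.eq_swap hpl hij hip hjp (hφ _ hmem).1.1 (by simp [θ']) (fun k hk => by simp [θ', hk]) k,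
          Equiv.swap_apply_of_ne_of_ne hki hkj, id]
  intro i j hij
  have flip : (∃ θ' ∈ houseΘS N,
      ∀ k, k ≠ j → k ≠ i → θ' k = hardProblem p k ∧ id k = φ θ' k) → ∃ θ' ∈ houseΘS N,
      ∀ k, k ≠ i → k ≠ j → θ' k = hardProblem p k ∧ id k = φ θ' k :=
    fun ⟨θ', hθ', h⟩ => ⟨θ', hθ', fun k hi hj => h k hj hi⟩
  by_cases hi : i = p
  · exact main i j hij (Or.inl hi)
  by_cases hj : j = p
  · exact flip (main j i hij.symm (Or.inl hj))
  by_cases hil : i = l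
  · exact flip (main j i hij.symm (Or.inr ⟨hlt j hj fun h => hij (hil.trans h.symm), hi⟩))
  · exact main i j hij (Or.inr ⟨hlt i hi hil, hj⟩)
end
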